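/- Let M be an operator on (ℂⁿ)^{⊗l} of one-way LOCC form: M = Σ_{i₂,…,i_l} P_{i₂,…,i_l} ⊗ Q_{2,i₂} ⊗ ⋯ ⊗ Q_{l,i_l}, where 0 ≤ P_{i₂,…,i_l} ≤ I for each index tuple and each Q_{j,i} is positive semidefinite with 0 ≤ Σ_{i_j} Q_{j,i_j} ≤ I for each 2 ≤ j ≤ l. For k ≥ l, introduce systems A_i^j ≅ ℂⁿ for i ∈ [k], j ∈ [l]; let M̃ be the operator on ⊗_{i,j} A_i^j acting as M on A₁¹ A₂² ⋯ A_l^l and as the identity on all other systems, and let B_i := A_i¹ ⋯ A_i^l. Then h_{Sep((ℂⁿ)^{⊗l})}(M) ≤ max over states ρ on B₁⊗⋯⊗B_k invariant under all permutations of the blocks B₁,…,B_k of tr(M̃ ρ) ≤ h_{Sep((ℂⁿ)^{⊗l})}(M) + √( 2 l³ ln(n) / (k − l) ). -/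

import Mathlib

/- Sandwich bound behind Corollary sos: for a one-way LOCC operator
   M = Σ_{i₂,…,i_l} P_{i₂,…,i_l} ⊗ Q_{2,i₂} ⊗ ⋯ ⊗ Q_{l,i_l} on (ℂⁿ)^{⊗l} (with l = l'+1),
   embedding M as M̃ on the blocks B₁,…,B_k (acting as M on A₁¹A₂²⋯A_l^l and as the
   identity elsewhere),
   h_Sep(M) ≤ max_{ρ block-permutation-invariant} tr(M̃ρ)
           ≤ h_Sep(M) + √(2 l³ ln(n)/(k−l)). -/

open scoped ComplexOrder BigOperators

noncomputable section

/-- A quantum state: positive semidefinite matrix of unit trace. -/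
def IsState {d : Type*} [Fintype d] [DecidableEq d] (ρ : Matrix d d ℂ) : Prop :=
  ρ.PosSemidef ∧ ρ.trace = 1

/-- Fully separable states on (ℂⁿ)^{⊗l}: convex combinations of product states. -/
def IsFullySeparable {n l : ℕ}
    (σ : Matrix (Fin l → Fin n) (Fin l → Fin n) ℂ) : Prop :=
  ∃ (N : ℕ) (w : Fin N → ℝ) (ρ : Fin N → Fin l → Matrix (Fin n) (Fin n) ℂ),
    (∀ i, 0 ≤ w i) ∧ (∑ i, w i) = 1 ∧ (∀ i j, IsState (ρ i j)) ∧
    σ = ∑ i, (w i : ℂ) • Matrix.of (fun f g => ∏ j, ρ i j (f j) (g j))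

/-- The support function h_Sep((ℂⁿ)^{⊗l})(M) = max_{σ ∈ Sep} tr(Mσ). -/
noncomputable def hSep {n l : ℕ}
    (M : Matrix (Fin l → Fin n) (Fin l → Fin n) ℂ) : ℝ :=
  sSup {v : ℝ | ∃ σ, IsFullySeparable σ ∧ v = ((M * σ).trace).re}

/-- The operator M̃ on ⊗_{i∈[k],j∈[l]} A_i^j acting as M on the diagonal systems
    A₁¹A₂²⋯A_l^l and as the identity on all other systems. -/
noncomputable def embedDiag {n l k : ℕ} (hlk : l ≤ k)
    (M : Matrix (Fin l → Fin n) (Fin l → Fin n) ℂ) :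
    Matrix (Fin k → Fin l → Fin n) (Fin k → Fin l → Fin n) ℂ :=
  Matrix.of fun g g' =>
    if ∀ (i : Fin k) (j : Fin l), (i : ℕ) ≠ (j : ℕ) → g i j = g' i j then
      M (fun j => g (Fin.castLE hlk j) j) (fun j => g' (Fin.castLE hlk j) j)
    else 0

/-- Maximum of tr(M̃ ρ) over states ρ on B₁ ⊗ ⋯ ⊗ B_k (with B_i = A_i¹⋯A_i^l) that are
    invariant under all permutations of the blocks B₁,…,B_k. -/
noncomputable def maxBlockSymValue {n l k : ℕ} (hlk : l ≤ k)
    (M : Matrix (Fin l → Fin n) (Fin l → Fin n) ℂ) : ℝ :=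
  sSup {v : ℝ | ∃ ρ : Matrix (Fin k → Fin l → Fin n) (Fin k → Fin l → Fin n) ℂ,
    IsState ρ ∧
    (∀ (π : Equiv.Perm (Fin k)) (f f' : Fin k → Fin l → Fin n),
      ρ (f ∘ π) (f' ∘ π) = ρ f f') ∧
    v = ((embedDiag hlk M * ρ).trace).re}

set_option linter.unusedSectionVars false

namespace DF
open Matrix

variable {d : Type*} [Fintype d] [DecidableEq d]

/-- Homogeneous von Neumann entropy: `tr D * S (D / tr D)`. -/
def entS (D : Matrix d d ℂ) : ℝ :=
  open Classical in
  if h : D.IsHermitian then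
    ∑ i, Real.negMulLog (h.eigenvalues i) - Real.negMulLog (∑ i, h.eigenvalues i)
  else 0

lemma psd_spectral {D : Matrix d d ℂ} (hD : D.PosSemidef) :
    ∃ (U : Matrix d d ℂ) (b : d → ℝ), (∀ i, 0 ≤ b i) ∧ U * Uᴴ = 1 ∧ Uᴴ * U = 1 ∧
      D = U * diagonal (fun i => (b i : ℂ)) * Uᴴ ∧ D.trace = ((∑ i, b i : ℝ) : ℂ) ∧
      entS D = ∑ i, Real.negMulLog (b i) - Real.negMulLog (∑ i, b i) := by
  refine ⟨hD.1.eigenvectorUnitary, hD.1.eigenvalues, hD.eigenvalues_nonneg, ?_, ?_, ?_, ?_, ?_⟩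
  · exact Unitary.coe_mul_star_self _
  · exact Unitary.coe_star_mul_self _
  · conv_lhs => rw [hD.1.spectral_theorem, Unitary.conjStarAlgAut_apply]
    rfl
  · rw [hD.1.trace_eq_sum_eigenvalues]; simp
  · simp [entS, hD.1]

lemma entS_nonneg {D : Matrix d d ℂ} (hD : D.PosSemidef) : 0 ≤ entS D := by
  obtain ⟨U, b, hb, -, -, -, -, h⟩ := psd_spectral hD
  rw [h]
  have : Real.negMulLog (∑ i, b i) = ∑ i, -(b i) * Real.log (∑ i, b i) := by
    rw [Real.negMulLog, ← Finset.sum_mul, Finset.sum_neg_distrib]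
  rw [this, ← Finset.sum_sub_distrib]
  apply Finset.sum_nonneg
  intro i _
  rw [Real.negMulLog]
  rcases (hb i).eq_or_lt with h0 | h0
  · simp [← h0]
  have h1 : b i ≤ ∑ i, b i := Finset.single_le_sum (fun i _ => hb i) (Finset.mem_univ i)
  have h2 := Real.log_le_log h0 h1
  nlinarith

lemma entS_le {D : Matrix d d ℂ} (hD : D.PosSemidef) :
    entS D ≤ D.trace.re * Real.log (Fintype.card d) := by
  obtain ⟨U, b, hb, -, -, -, ht, h⟩ := psd_spectral hD
  rw [h, ht, Complex.ofReal_re]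
  set t := ∑ i, b i with htd
  have ht0 : 0 ≤ t := Finset.sum_nonneg fun i _ => hb i
  have : Real.negMulLog t = ∑ i, -(b i) * Real.log t := by
    rw [Real.negMulLog, ← Finset.sum_mul, Finset.sum_neg_distrib]
  rw [this, ← Finset.sum_sub_distrib]
  rcases ht0.eq_or_lt with h0 | h0
  · have hz : ∀ i, b i = 0 := by
      intro i
      have h1 : b i ≤ ∑ i, b i := Finset.single_le_sum (fun i _ => hb i) (Finset.mem_univ i)
      exact le_antisymm (h1.trans h0.symm.le) (hb i)
    simp [hz, ← h0]
  have hne : Nonempty d := by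
    by_contra hc
    rw [not_nonempty_iff] at hc
    simp [htd] at h0
  have hc : (0:ℝ) < Fintype.card d := by exact_mod_cast Fintype.card_pos
  set N : ℝ := ((Fintype.card d : ℕ) : ℝ) with hN
  have key : ∀ i, Real.negMulLog (b i) - -(b i) * Real.log t ≤
      b i * Real.log N + t / N - b i := by
    intro i
    rw [Real.negMulLog]
    rcases (hb i).eq_or_lt with h1 | h1
    · rw [← h1]; simp; positivity
    have h2 := Real.log_le_sub_one_of_pos (x := t / (N * b i)) (by positivity)
    rw [Real.log_div h0.ne' (by positivity), Real.log_mul hc.ne' h1.ne'] at h2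
    have h3 : b i * (Real.log t - (Real.log N + Real.log (b i))) ≤ b i * (t / (N * b i) - 1) :=
      mul_le_mul_of_nonneg_left h2 h1.le
    have h4 : b i * (t / (N * b i) - 1) = t / N - b i := by field_simp
    linarith
  calc _ ≤ ∑ i, (b i * Real.log N + t / N - b i) := Finset.sum_le_sum fun i _ => key i
    _ = t * Real.log N := by
      rw [Finset.sum_sub_distrib, Finset.sum_add_distrib, ← Finset.sum_mul, ← htd]
      simp only [Finset.sum_const, Finset.card_univ, nsmul_eq_mul]
      change _ + N * (t / N) - t = _
      field_simp
      ring

lemma scalar_kl {a b : ℝ} (ha : 0 ≤ a) (hb : 0 < b) :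
    (√a - √b) ^ 2 ≤ a * Real.log a - a * Real.log b - a + b := by
  rcases ha.eq_or_lt with h | h
  · simp [← h, Real.sq_sqrt hb.le]
  obtain ⟨x, hx, rfl⟩ : ∃ x, 0 < x ∧ a = x ^ 2 := ⟨√a, Real.sqrt_pos.2 h, (Real.sq_sqrt ha).symm⟩
  obtain ⟨y, hy, rfl⟩ : ∃ x, 0 < x ∧ b = x ^ 2 :=
    ⟨√b, Real.sqrt_pos.2 hb, (Real.sq_sqrt hb.le).symm⟩
  rw [Real.sqrt_sq hx.le, Real.sqrt_sq hy.le, Real.log_pow, Real.log_pow]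
  have := Real.log_le_sub_one_of_pos (x := y / x) (by positivity)
  rw [Real.log_div hy.ne' hx.ne'] at this
  have h2 : x ^ 2 * (Real.log y - Real.log x) ≤ x ^ 2 * (y / x - 1) :=
    mul_le_mul_of_nonneg_left this (by positivity)
  have h3 : x ^ 2 * (y / x - 1) = x * y - x ^ 2 := by field_simp
  push_cast
  nlinarith

lemma sum_kl (a κ : d → ℝ) (o : d → d → ℝ) (ha : ∀ i, 0 ≤ a i) (hκ : ∀ i, 0 ≤ κ i)
    (ho : ∀ i j, 0 ≤ o i j) (h1 : ∀ i, ∑ j, o i j = 1) (h2 : ∀ j, ∑ i, o i j = 1)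
    (hker : ∀ j, κ j = 0 → ∑ i, o i j * a i = 0) (hs : ∑ i, a i = ∑ j, κ j) :
    ∑ i, ∑ j, o i j * (√(a i) - √(κ j)) ^ 2 ≤
      ∑ i, a i * Real.log (a i) - ∑ j, (∑ i, o i j * a i) * Real.log (κ j) := by
  have key : ∀ i j, o i j * (√(a i) - √(κ j)) ^ 2 ≤
      o i j * (a i * Real.log (a i)) - o i j * a i * Real.log (κ j) - o i j * a i
        + o i j * κ j := by
    intro i j
    rcases (hκ j).eq_or_lt with h | h
    · have h0 := (Finset.sum_eq_zero_iff_of_nonneg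
        (fun i _ => mul_nonneg (ho i j) (ha i))).1 (hker j h.symm) i (Finset.mem_univ i)
      rw [← h]
      simp only [Real.sqrt_zero, sub_zero, Real.sq_sqrt (ha i), Real.log_zero, mul_zero, h0]
      rw [← mul_assoc, h0]; simp
    · have := mul_le_mul_of_nonneg_left (scalar_kl (ha i) h) (ho i j)
      linarith
  calc _ ≤ ∑ i, ∑ j, (o i j * (a i * Real.log (a i)) - o i j * a i * Real.log (κ j)
        - o i j * a i + o i j * κ j) :=
        Finset.sum_le_sum fun i _ => Finset.sum_le_sum fun j _ => key i j
    _ = _ := by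
      simp only [Finset.sum_add_distrib, Finset.sum_sub_distrib]
      have e1 : ∑ i, ∑ j, o i j * (a i * Real.log (a i)) = ∑ i, a i * Real.log (a i) := by
        refine Finset.sum_congr rfl fun i _ => ?_
        rw [← Finset.sum_mul, h1, one_mul]
      have e2 : ∑ i, ∑ j, o i j * a i = ∑ i, a i := by
        refine Finset.sum_congr rfl fun i _ => ?_
        rw [← Finset.sum_mul, h1, one_mul]
      have e3 : ∑ i, ∑ j, o i j * κ j = ∑ j, κ j := by
        rw [Finset.sum_comm]
        refine Finset.sum_congr rfl fun i _ => ?_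
        rw [← Finset.sum_mul, h2, one_mul]
      have e4 : ∑ i, ∑ j, o i j * a i * Real.log (κ j) =
          ∑ j, (∑ i, o i j * a i) * Real.log (κ j) := by
        rw [Finset.sum_comm]
        refine Finset.sum_congr rfl fun i _ => ?_
        rw [Finset.sum_mul]
      rw [e1, e2, e3, e4]; linarith

lemma normSq_row (A : Matrix d d ℂ) (i : d) :
    ((∑ j, ‖A i j‖ ^ 2 : ℝ) : ℂ) = (A * Aᴴ) i i := by
  rw [Matrix.mul_apply]; push_cast
  refine Finset.sum_congr rfl fun j _ => ?_
  rw [conjTranspose_apply, Complex.star_def, Complex.mul_conj, Complex.normSq_eq_norm_sq]; simp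

lemma normSq_col (A : Matrix d d ℂ) (i : d) :
    ((∑ j, ‖A j i‖ ^ 2 : ℝ) : ℂ) = (Aᴴ * A) i i := by
  have := normSq_row Aᴴ i
  simpa using this

lemma trace_mul_psd {A B : Matrix d d ℂ} (hA : A.PosSemidef) (hB : B.PosSemidef) :
    0 ≤ (A * B).trace := by
  obtain ⟨U, b, hb, -, -, h, -⟩ := psd_spectral hB
  have h2 := (hA.conjTranspose_mul_mul_same U)
  rw [h, ← mul_assoc, trace_mul_comm, ← mul_assoc, ← mul_assoc, trace]
  apply Finset.sum_nonneg
  intro i _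
  rw [diag_apply, mul_diagonal]
  exact mul_nonneg (h2.diag_nonneg) (by exact_mod_cast hb i)

lemma effect_sub_sq {G : Matrix d d ℂ} (hG : G.PosSemidef) (hG1 : (1 - G).PosSemidef) :
    (G - G * G).PosSemidef := by
  have h1 := hG1.conjTranspose_mul_mul_same G
  have h2 := hG.conjTranspose_mul_mul_same (1 - G)
  rw [hG.1.eq] at h1
  rw [hG1.1.eq] at h2
  have := h1.add h2
  convert this using 1
  noncomm_ring

lemma pinsker (U V G : Matrix d d ℂ) (a κ : d → ℝ) (t : ℝ)
    (hU : U * Uᴴ = 1) (hU' : Uᴴ * U = 1) (hV : V * Vᴴ = 1) (hV' : Vᴴ * V = 1)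
    (ha : ∀ i, 0 ≤ a i) (hκ : ∀ i, 0 ≤ κ i)
    (hG : G.PosSemidef) (hG1 : (1 - G).PosSemidef)
    (hat : ∑ i, a i = t) (hκt : ∑ i, κ i = t)
    (ρ σ : Matrix d d ℂ) (hρ : ρ = U * diagonal (fun i => (a i : ℂ)) * Uᴴ)
    (hσ : σ = V * diagonal (fun i => (κ i : ℂ)) * Vᴴ)
    (w : d → ℝ) (hw : ∀ j, (w j : ℂ) = (Vᴴ * ρ * V) j j)
    (hker : ∀ j, κ j = 0 → w j = 0) :
    ‖(G * (ρ - σ)).trace‖ ^ 2 ≤ t * (∑ i, a i * Real.log (a i) - ∑ j, w j * Real.log (κ j)) := by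
  set O := Uᴴ * V with hO
  set G' : Matrix d d ℂ := G - (1/2 : ℂ) • 1 with hG'
  set K := Vᴴ * G' * U with hK
  have hG'h : G'ᴴ = G' := by
    rw [hG', conjTranspose_sub, hG.1.eq]; simp
  have hOO : O * Oᴴ = 1 := by
    rw [hO, conjTranspose_mul, conjTranspose_conjTranspose]
    calc Uᴴ * V * (Vᴴ * U) = Uᴴ * (V * Vᴴ) * U := by simp only [mul_assoc]
      _ = 1 := by rw [hV, mul_one, hU']
  have hOO' : Oᴴ * O = 1 := by
    rw [hO, conjTranspose_mul, conjTranspose_conjTranspose]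
    calc Vᴴ * U * (Uᴴ * V) = Vᴴ * (U * Uᴴ) * V := by simp only [mul_assoc]
      _ = 1 := by rw [hU, mul_one, hV']
  have trρ : ρ.trace = (t : ℂ) := by
    rw [hρ, trace_mul_comm, ← mul_assoc, hU', one_mul, trace_diagonal, ← hat]; simp
  have trσ : σ.trace = (t : ℂ) := by
    rw [hσ, trace_mul_comm, ← mul_assoc, hV', one_mul, trace_diagonal, ← hκt]; simp
  have ρpsd : ρ.PosSemidef := by
    rw [hρ]
    exact (PosSemidef.diagonal (fun i => by simpa using ha i)).mul_mul_conjTranspose_same U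
  have σpsd : σ.PosSemidef := by
    rw [hσ]
    exact (PosSemidef.diagonal (fun i => by simpa using hκ i)).mul_mul_conjTranspose_same V
  have e0 : (G * (ρ - σ)).trace = (G' * (ρ - σ)).trace := by
    rw [hG', sub_mul, trace_sub]
    simp [trρ, trσ]
  have e1 : (G' * (ρ - σ)).trace = ∑ i, ∑ j, ((a i : ℂ) - κ j) * O i j * K j i := by
    have h1 : (G' * ρ).trace = ∑ i, ∑ j, (a i : ℂ) * O i j * K j i := by
      have : (G' * ρ).trace = (diagonal (fun i => (a i : ℂ)) * (O * K)).trace := by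
        rw [hρ, hO, hK]
        calc _ = (G' * U * diagonal (fun i => (a i : ℂ)) * Uᴴ).trace := by simp only [mul_assoc]
          _ = (Uᴴ * (G' * U * diagonal (fun i => (a i : ℂ)))).trace := by rw [trace_mul_comm]
          _ = (Uᴴ * (V * Vᴴ) * G' * U * diagonal (fun i => (a i : ℂ))).trace := by
            rw [hV, mul_one]; simp only [mul_assoc]
          _ = _ := by rw [trace_mul_comm]; simp only [mul_assoc]
      rw [this, trace]
      refine Finset.sum_congr rfl fun i _ => ?_
      rw [diag_apply, diagonal_mul, Matrix.mul_apply, Finset.mul_sum]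
      refine Finset.sum_congr rfl fun j _ => ?_
      ring
    have h2 : (G' * σ).trace = ∑ i, ∑ j, (κ j : ℂ) * O i j * K j i := by
      have : (G' * σ).trace = (diagonal (fun i => (κ i : ℂ)) * (K * O)).trace := by
        rw [hσ, hO, hK]
        calc _ = (G' * V * diagonal (fun i => (κ i : ℂ)) * Vᴴ).trace := by simp only [mul_assoc]
          _ = (Vᴴ * (G' * V * diagonal (fun i => (κ i : ℂ)))).trace := by rw [trace_mul_comm]
          _ = (Vᴴ * G' * (U * Uᴴ) * V * diagonal (fun i => (κ i : ℂ))).trace := by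
            rw [hU, mul_one]; simp only [mul_assoc]
          _ = _ := by rw [trace_mul_comm]; simp only [mul_assoc]
      rw [this, trace, Finset.sum_comm]
      refine Finset.sum_congr rfl fun i _ => ?_
      rw [diag_apply, diagonal_mul, Matrix.mul_apply, Finset.mul_sum]
      refine Finset.sum_congr rfl fun j _ => ?_
      ring
    rw [mul_sub, trace_sub, h1, h2, ← Finset.sum_sub_distrib]
    refine Finset.sum_congr rfl fun i _ => ?_
    rw [← Finset.sum_sub_distrib]
    refine Finset.sum_congr rfl fun j _ => ?_
    ring
  have hq : ∀ τ : Matrix d d ℂ, τ.PosSemidef → τ.trace = (t : ℂ) →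
      ((G' * G') * τ).trace.re ≤ t / 4 := by
    intro τ hτ hτt
    have := trace_mul_psd (effect_sub_sq hG hG1) hτ
    have e : ((G' * G') * τ).trace = (1/4 : ℂ) * τ.trace - ((G - G * G) * τ).trace := by
      have : G' * G' = (1/4 : ℂ) • 1 - (G - G * G) := by
        rw [hG', sub_mul, mul_sub, mul_sub, smul_mul_smul_comm]
        simp only [mul_smul_comm, smul_mul_assoc, mul_one, one_mul]
        have hh : G = (1/2:ℂ) • G + (1/2:ℂ) • G := by rw [← add_smul]; norm_num
        conv_rhs => rw [hh]
        norm_num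
        nth_rewrite 3 4 [hh]
        simp only [mul_add, add_mul, smul_mul_assoc, mul_smul_comm, smul_smul, smul_add]
        module
      rw [this, sub_mul, trace_sub]; simp
    rw [e, hτt, Complex.sub_re]
    have h3 := (Complex.le_def.1 this).1
    simp at h3 ⊢
    linarith
  have q1 : ∑ i, ∑ j, a i * ‖K j i‖ ^ 2 ≤ t / 4 := by
    have : (((∑ i, ∑ j, a i * ‖K j i‖ ^ 2 : ℝ)) : ℂ) = ((G' * G') * ρ).trace := by
      have : ((G' * G') * ρ).trace = (diagonal (fun i => (a i : ℂ)) * (Kᴴ * K)).trace := by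
        rw [hρ, hK]
        simp only [conjTranspose_mul, conjTranspose_conjTranspose, hG'h]
        calc _ = ((G' * G' * U * diagonal (fun i => (a i : ℂ))) * Uᴴ).trace := by
              simp only [mul_assoc]
          _ = (Uᴴ * (G' * 1 * G' * U * diagonal (fun i => (a i : ℂ)))).trace := by
            rw [trace_mul_comm, mul_one]
          _ = _ := by rw [← hV, trace_mul_comm (diagonal _)]; simp only [mul_assoc]
      rw [this, trace]; push_cast
      refine Finset.sum_congr rfl fun i _ => ?_
      rw [diag_apply, diagonal_mul, ← normSq_col, ← Finset.mul_sum]; push_cast; rfl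
    have h := hq ρ ρpsd trρ
    rw [← this] at h; simpa only [Complex.ofReal_re] using h
  have q2 : ∑ i, ∑ j, κ j * ‖K j i‖ ^ 2 ≤ t / 4 := by
    have : (((∑ i, ∑ j, κ j * ‖K j i‖ ^ 2 : ℝ)) : ℂ) = ((G' * G') * σ).trace := by
      have : ((G' * G') * σ).trace = (diagonal (fun i => (κ i : ℂ)) * (K * Kᴴ)).trace := by
        rw [hσ, hK]
        simp only [conjTranspose_mul, conjTranspose_conjTranspose, hG'h]
        calc _ = ((G' * G' * V * diagonal (fun i => (κ i : ℂ))) * Vᴴ).trace := by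
              simp only [mul_assoc]
          _ = (Vᴴ * (G' * 1 * G' * V * diagonal (fun i => (κ i : ℂ)))).trace := by
            rw [trace_mul_comm, mul_one]
          _ = _ := by rw [← hU, trace_mul_comm (diagonal _)]; simp only [mul_assoc]
      rw [this, trace, Finset.sum_comm]; push_cast
      refine Finset.sum_congr rfl fun i _ => ?_
      rw [diag_apply, diagonal_mul, ← normSq_row, ← Finset.mul_sum]; push_cast; rfl
    have h := hq σ σpsd trσ
    rw [← this] at h; simpa only [Complex.ofReal_re] using h
  have hwO : ∀ j, ∑ i, ‖O i j‖ ^ 2 * a i = w j := by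
    intro j
    have : ((∑ i, ‖O i j‖ ^ 2 * a i : ℝ) : ℂ) = (w j : ℂ) := by
      rw [hw, hρ]
      have : Vᴴ * (U * diagonal (fun i => (a i : ℂ)) * Uᴴ) * V =
          Oᴴ * diagonal (fun i => (a i : ℂ)) * O := by
        rw [hO, conjTranspose_mul, conjTranspose_conjTranspose]; simp only [mul_assoc]
      rw [this, Matrix.mul_apply]; push_cast
      refine Finset.sum_congr rfl fun i _ => ?_
      rw [mul_diagonal, conjTranspose_apply, Complex.star_def]
      have : (starRingEnd ℂ) (O i j) * O i j = ((‖O i j‖ ^ 2 : ℝ) : ℂ) := by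
        rw [mul_comm, Complex.mul_conj, Complex.normSq_eq_norm_sq]
      push_cast at this
      rw [← this]; ring
    exact_mod_cast this
  have hkl := sum_kl a κ (fun i j => ‖O i j‖ ^ 2) ha hκ (fun i j => by positivity)
    (fun i => by
      have := normSq_row O i
      rw [hOO, one_apply_eq] at this; exact_mod_cast this)
    (fun i => by
      have := normSq_col O i
      rw [hOO', one_apply_eq] at this; exact_mod_cast this)
    (fun j hj => by rw [hwO]; exact hker j hj) (hat.trans hκt.symm)
  simp only [hwO] at hkl
  set δ := ∑ i, a i * Real.log (a i) - ∑ j, w j * Real.log (κ j)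
  have ht0 : 0 ≤ t := hat ▸ Finset.sum_nonneg fun i _ => ha i
  have n1 : ‖(G * (ρ - σ)).trace‖ ≤
      ∑ p : d × d, (|√(a p.1) - √(κ p.2)| * ‖O p.1 p.2‖) *
        ((√(a p.1) + √(κ p.2)) * ‖K p.2 p.1‖) := by
    rw [e0, e1, ← Fintype.sum_prod_type' (fun i j => ((a i : ℂ) - κ j) * O i j * K j i)]
    refine (norm_sum_le _ _).trans (Finset.sum_le_sum fun p _ => le_of_eq ?_)
    rw [norm_mul, norm_mul, ← Complex.ofReal_sub, Complex.norm_real, Real.norm_eq_abs]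
    have : a p.1 - κ p.2 = (√(a p.1) - √(κ p.2)) * (√(a p.1) + √(κ p.2)) := by
      have h1 := Real.sq_sqrt (ha p.1)
      have h2 := Real.sq_sqrt (hκ p.2)
      nlinarith
    rw [this, abs_mul, abs_of_nonneg (by positivity : 0 ≤ √(a p.1) + √(κ p.2))]
    ring
  have n2 := Finset.sum_mul_sq_le_sq_mul_sq (Finset.univ : Finset (d × d))
    (fun p => |√(a p.1) - √(κ p.2)| * ‖O p.1 p.2‖)
    (fun p => (√(a p.1) + √(κ p.2)) * ‖K p.2 p.1‖)
  have n3 : ∑ p : d × d, (|√(a p.1) - √(κ p.2)| * ‖O p.1 p.2‖) ^ 2 ≤ δ := by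
    rw [Fintype.sum_prod_type]
    refine le_trans (le_of_eq ?_) hkl
    refine Finset.sum_congr rfl fun i _ => Finset.sum_congr rfl fun j _ => ?_
    rw [mul_pow, sq_abs]; ring
  have n4 : ∑ p : d × d, ((√(a p.1) + √(κ p.2)) * ‖K p.2 p.1‖) ^ 2 ≤ t := by
    rw [Fintype.sum_prod_type]
    calc _ ≤ ∑ i, ∑ j, (2 * (a i * ‖K j i‖ ^ 2) + 2 * (κ j * ‖K j i‖ ^ 2)) := by
          refine Finset.sum_le_sum fun i _ => Finset.sum_le_sum fun j _ => ?_
          simp only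
          rw [mul_pow, ← mul_assoc, ← mul_assoc, ← add_mul]
          refine mul_le_mul_of_nonneg_right ?_ (by positivity)
          have h1 := Real.sq_sqrt (ha i)
          have h2 := Real.sq_sqrt (hκ j)
          nlinarith [sq_nonneg (√(a i) - √(κ j))]
      _ ≤ t := by
          simp only [Finset.sum_add_distrib, ← Finset.mul_sum] at q1 q2 ⊢
          linarith
  calc _ ≤ (∑ p : d × d, (|√(a p.1) - √(κ p.2)| * ‖O p.1 p.2‖) *
        ((√(a p.1) + √(κ p.2)) * ‖K p.2 p.1‖)) ^ 2 := pow_le_pow_left₀ (norm_nonneg _) n1 2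
    _ ≤ _ := n2
    _ ≤ δ * t := mul_le_mul n3 n4 (Finset.sum_nonneg fun _ _ => sq_nonneg _)
        ((Finset.sum_nonneg fun _ _ => sq_nonneg _).trans n3)
    _ = t * δ := mul_comm _ _

end DF

namespace DF
open Matrix

variable {d : Type*} [Fintype d] [DecidableEq d]

lemma psd_re {A B : Matrix d d ℂ} (hA : A.PosSemidef) (hB : B.PosSemidef) :
    (A * B).trace = (((A * B).trace.re : ℝ) : ℂ) := by
  have := (Complex.le_def.1 (trace_mul_psd hA hB)).2
  apply Complex.ext <;> simp at this ⊢
  exact this.symm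

lemma psd_trace_re {A : Matrix d d ℂ} (hA : A.PosSemidef) :
    A.trace = ((A.trace.re : ℝ) : ℂ) := by
  have := psd_re PosSemidef.one hA
  simpa using this

lemma psd_trace_re_nonneg {A : Matrix d d ℂ} (hA : A.PosSemidef) : 0 ≤ A.trace.re :=
  (Complex.le_def.1 hA.trace_nonneg).1

lemma psd_diag_re {A : Matrix d d ℂ} (hA : A.PosSemidef) (i : d) :
    (((A i i).re : ℝ) : ℂ) = A i i := by
  have := (Complex.le_def.1 (hA.diag_nonneg (i := i))).2
  apply Complex.ext <;> simp at this ⊢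
  exact this

lemma sum_sqrt_mul_sqrt_le' {Y : Type*} (s : Finset Y) (f g : Y → ℝ) (hf : ∀ y ∈ s, 0 ≤ f y)
    (hg : ∀ y ∈ s, 0 ≤ g y) :
    ∑ i ∈ s, √(f i) * √(g i) ≤ √(∑ i ∈ s, f i) * √(∑ i ∈ s, g i) := by
  have := Real.sum_mul_le_sqrt_mul_sqrt s (fun x => √(f x)) (fun x => √(g x))
  rwa [Finset.sum_congr rfl fun y hy => Real.sq_sqrt (hf y hy),
    Finset.sum_congr rfl fun y hy => Real.sq_sqrt (hg y hy)] at this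

lemma ensemble_bound {Y : Type*} (s : Finset Y) (D G : Y → Matrix d d ℂ)
    (hD : ∀ y ∈ s, (D y).PosSemidef) (hG : ∀ y ∈ s, (G y).PosSemidef)
    (hG1 : ∀ y ∈ s, (1 - G y).PosSemidef) :
    ∑ y ∈ s, ‖(G y * (D y - ((D y).trace / (∑ y ∈ s, D y).trace) • ∑ y ∈ s, D y)).trace‖ ≤
      √((∑ y ∈ s, D y).trace.re * (entS (∑ y ∈ s, D y) - ∑ y ∈ s, entS (D y))) ∧
    ∑ y ∈ s, entS (D y) ≤ entS (∑ y ∈ s, D y) := by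
  set Db := ∑ y ∈ s, D y with hDb
  have hDbp : Db.PosSemidef := posSemidef_sum s hD
  obtain ⟨V, b, hb, hV, hV', hDV, htr, hent⟩ := psd_spectral hDbp
  set t := ∑ i, b i with ht
  have ht0 : 0 ≤ t := Finset.sum_nonneg fun i _ => hb i
  set w : Y → d → ℝ := fun y j => ((Vᴴ * D y * V) j j).re with hw
  have hwC : ∀ y ∈ s, ∀ j, (w y j : ℂ) = (Vᴴ * D y * V) j j := fun y hy j =>
    psd_diag_re ((hD y hy).conjTranspose_mul_mul_same V) j
  have hw0 : ∀ y ∈ s, ∀ j, 0 ≤ w y j := fun y hy j =>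
    (Complex.le_def.1 (((hD y hy).conjTranspose_mul_mul_same V).diag_nonneg (i := j))).1
  have hwsum : ∀ j, ∑ y ∈ s, w y j = b j := by
    intro j
    have : ((∑ y ∈ s, w y j : ℝ) : ℂ) = (b j : ℂ) := by
      push_cast
      rw [Finset.sum_congr rfl fun y hy => hwC y hy j, ← Matrix.sum_apply,
        ← Finset.sum_mul, ← Finset.mul_sum, ← hDb, hDV]
      have : Vᴴ * (V * diagonal (fun i => (b i : ℂ)) * Vᴴ) * V = diagonal (fun i => (b i : ℂ)) := by
        calc _ = (Vᴴ * V) * diagonal (fun i => (b i : ℂ)) * (Vᴴ * V) := by simp only [mul_assoc]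
          _ = _ := by rw [hV', one_mul, mul_one]
      rw [this, diagonal_apply_eq]
    exact_mod_cast this
  set ty : Y → ℝ := fun y => (D y).trace.re with hty
  have htyC : ∀ y ∈ s, (D y).trace = (ty y : ℂ) := fun y hy => psd_trace_re (hD y hy)
  have hty0 : ∀ y ∈ s, 0 ≤ ty y := fun y hy => psd_trace_re_nonneg (hD y hy)
  have htysum : ∑ y ∈ s, ty y = t := by
    have : ((∑ y ∈ s, ty y : ℝ) : ℂ) = (t : ℂ) := by
      push_cast
      rw [← htr, hDb, trace_sum]
      exact Finset.sum_congr rfl fun y hy => (htyC y hy).symm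
    exact_mod_cast this
  have hwty : ∀ y ∈ s, ∑ j, w y j = ty y := by
    intro y hy
    have : ((∑ j, w y j : ℝ) : ℂ) = (ty y : ℂ) := by
      push_cast
      rw [Finset.sum_congr rfl fun j _ => hwC y hy j, ← htyC y hy]
      change (Vᴴ * D y * V).trace = _
      rw [trace_mul_comm, ← mul_assoc, hV, one_mul]
    exact_mod_cast this
  set δ : Y → ℝ := fun y => - entS (D y) + ty y * Real.log t - ∑ j, w y j * Real.log (b j) with hδ
  have hδsum : ∑ y ∈ s, δ y = entS Db - ∑ y ∈ s, entS (D y) := by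
    rw [hδ, Finset.sum_sub_distrib, Finset.sum_add_distrib, ← Finset.sum_mul, htysum,
      Finset.sum_comm, hent, Finset.sum_neg_distrib]
    simp only [← Finset.sum_mul, hwsum, Real.negMulLog]
    simp only [neg_mul, Finset.sum_neg_distrib]
    ring
  have main : ∀ y ∈ s, ∀ G : Matrix d d ℂ, G.PosSemidef → (1 - G).PosSemidef →
      ‖(G * (D y - ((D y).trace / Db.trace) • Db)).trace‖ ^ 2 ≤ ty y * δ y ∧ 0 ≤ δ y := by
    intro y hy G hG hG1
    rcases (hty0 y hy).eq_or_lt with h0 | h0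
    · have hz : D y = 0 := by
        rw [← (hD y hy).trace_eq_zero_iff, htyC y hy, ← h0]; simp
      have hw0 : ∀ j, w y j = 0 := by intro j; simp [hw, hz]
      have he : entS (D y) = 0 := by
        refine le_antisymm ?_ (entS_nonneg (hD y hy))
        refine (entS_le (hD y hy)).trans ?_
        rw [htyC y hy, ← h0]; simp
      have h6 : δ y = 0 := by simp [hδ, ← h0, he, hw0]
      rw [h6, ← h0]; simp [hz]
    obtain ⟨U, a, ha, hU, hU', hDU, hatr, haent⟩ := psd_spectral (hD y hy)
    have hat : ∑ i, a i = ty y := by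
      have := hatr.symm.trans (htyC y hy)
      exact_mod_cast this
    have htpos : 0 < t := by
      rw [← htysum]
      exact h0.trans_le (Finset.single_le_sum (fun y hy => hty0 y hy) hy)
    set c := ty y / t with hc
    have hcpos : 0 < c := by positivity
    have hcC : (D y).trace / Db.trace = (c : ℂ) := by rw [htyC y hy, htr, hc]; push_cast; rfl
    have hp := pinsker U V G a (fun j => c * b j) (ty y) hU hU' hV hV' ha
      (fun j => mul_nonneg hcpos.le (hb j)) hG hG1 hat
      (by rw [← Finset.mul_sum, ← ht, hc]; field_simp) (D y) ((c : ℂ) • Db) hDU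
      (by
        rw [hDV, ← smul_mul_assoc, ← mul_smul_comm, ← diagonal_smul]
        congr 3
        ext i; simp) (w y) (hwC y hy)
      (by
        intro j hj
        have hbj : b j = 0 := by
          rcases mul_eq_zero.1 hj with h | h
          · exact absurd h hcpos.ne'
          · exact h
        have h3 := hwsum j
        rw [hbj] at h3
        exact (Finset.sum_eq_zero_iff_of_nonneg (fun y hy => hw0 y hy j)).1 h3 y hy)
    have hδe : ∑ i, a i * Real.log (a i) - ∑ j, w y j * Real.log (c * b j) = δ y := by
      have h1 : ∀ j, w y j * Real.log (c * b j) =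
          w y j * (Real.log (ty y) - Real.log t) + w y j * Real.log (b j) := by
        intro j
        rcases eq_or_ne (b j) 0 with hbj | hbj
        · have h3 := hwsum j
          rw [hbj] at h3
          have := (Finset.sum_eq_zero_iff_of_nonneg (fun y hy => hw0 y hy j)).1 h3 y hy
          rw [this]; simp
        · rw [Real.log_mul hcpos.ne' hbj, hc, Real.log_div h0.ne' htpos.ne']; ring
      simp only [h1, Finset.sum_add_distrib, ← Finset.sum_mul, hwty y hy, hδ, haent, hat,
        Real.negMulLog]
      simp only [neg_mul, Finset.sum_neg_distrib]
      ring
    rw [hδe] at hp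
    rw [hcC]
    refine ⟨hp, ?_⟩
    have := (sq_nonneg _).trans hp
    exact nonneg_of_mul_nonneg_right this h0
  have hδ0 : ∀ y ∈ s, 0 ≤ δ y := fun y hy =>
    (main y hy 0 PosSemidef.zero (by simpa using PosSemidef.one)).2
  constructor
  · have hre : Db.trace.re = ∑ y ∈ s, ty y := by rw [htr, Complex.ofReal_re, htysum]
    rw [← hδsum, hre]
    calc _ ≤ ∑ y ∈ s, √(ty y) * √(δ y) := by
          refine Finset.sum_le_sum fun y hy => ?_
          rw [← Real.sqrt_mul (hty0 y hy)]
          exact Real.le_sqrt_of_sq_le (main y hy (G y) (hG y hy) (hG1 y hy)).1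
      _ ≤ √(∑ y ∈ s, ty y) * √(∑ y ∈ s, δ y) :=
          sum_sqrt_mul_sqrt_le' s _ _ hty0 hδ0
      _ = _ := by rw [Real.sqrt_mul (Finset.sum_nonneg hty0)]
  · have := Finset.sum_nonneg hδ0
    rw [hδsum] at this; linarith

end DF

namespace DF
open Matrix

/-- A symmetric positive functional on lists of block operators, together with
subsystem embeddings and a measurement on the blocks. -/
structure Sys (k : ℕ) (d β Ω C : Type) [Fintype d] [DecidableEq d] [Fintype β] [DecidableEq β]
    [Fintype Ω] where
  V : List (Matrix β β ℂ) → ℂ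
  Vlin : List (Matrix β β ℂ) → (Matrix β β ℂ →ₗ[ℂ] ℂ)
  V_cons : ∀ X L, V (X :: L) = Vlin L X
  V_perm : ∀ L L' : List (Matrix β β ℂ), L.Perm L' → L.length ≤ k → V L = V L'
  V_one : ∀ L : List (Matrix β β ℂ), L.length < k → V (1 :: L) = V L
  V_pos : ∀ L : List (Matrix β β ℂ), (∀ X ∈ L, X.PosSemidef) → 0 ≤ V L
  V_nil : V [] = 1
  emb : C → Matrix d d ℂ →ₗ[ℂ] Matrix β β ℂ
  emb_one : ∀ c, emb c 1 = 1
  emb_psd : ∀ c G, G.PosSemidef → (emb c G).PosSemidef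
  E : Ω → Matrix β β ℂ
  E_psd : ∀ x, (E x).PosSemidef
  E_sum : ∑ x, E x = 1

variable {k : ℕ} {d β Ω C : Type} [Fintype d] [DecidableEq d] [Fintype β] [DecidableEq β]
    [Fintype Ω]

namespace Sys
variable (S : Sys k d β Ω C)

/-- all entries positive semidefinite -/
def Good (L : List (Matrix β β ℂ)) : Prop := ∀ X ∈ L, X.PosSemidef

lemma Good.cons {X : Matrix β β ℂ} {L : List (Matrix β β ℂ)} (hX : X.PosSemidef) (hL : Good L) :
    Good (X :: L) := by
  intro Y hY
  rcases List.mem_cons.1 hY with h | h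
  · rwa [h]
  · exact hL Y h

lemma Good.append {L L' : List (Matrix β β ℂ)} (hL : Good L) (hL' : Good L') :
    Good (L ++ L') := by
  intro Y hY
  rcases List.mem_append.1 hY with h | h
  · exact hL Y h
  · exact hL' Y h

lemma Good.ofFn {t : ℕ} {f : Fin t → Matrix β β ℂ} (hf : ∀ j, (f j).PosSemidef) :
    Good (List.ofFn f) := by
  intro Y hY
  obtain ⟨j, rfl⟩ := (List.mem_ofFn' f Y).1 hY
  exact hf j

/-- The (unnormalized) conditional state of subsystem `c` of one more block. -/
def Dm (c : C) (L : List (Matrix β β ℂ)) : Matrix d d ℂ :=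
  Matrix.of fun b a => S.V (S.emb c (Matrix.single a b 1) :: L)

lemma trace_Dm (c : C) (L : List (Matrix β β ℂ)) (G : Matrix d d ℂ) :
    (G * S.Dm c L).trace = S.V (S.emb c G :: L) := by
  conv_rhs => rw [matrix_eq_sum_single G]
  simp only [V_cons, map_sum]
  rw [trace]
  refine Finset.sum_congr rfl fun a _ => ?_
  rw [diag_apply, Matrix.mul_apply]
  refine Finset.sum_congr rfl fun b _ => ?_
  have : Matrix.single a b (G a b) = (G a b) • Matrix.single a b (1 : ℂ) := by
    rw [smul_single, smul_eq_mul, mul_one]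
  rw [this, map_smul, map_smul, Dm, of_apply, V_cons, smul_eq_mul]

lemma Dm_psd (c : C) (L : List (Matrix β β ℂ)) (hL : Good L) : (S.Dm c L).PosSemidef := by
  have key : ∀ x : d → ℂ, 0 ≤ star x ⬝ᵥ (S.Dm c L) *ᵥ x := by
    intro x
    have h1 : (vecMulVec x (star x)).PosSemidef := posSemidef_vecMulVec_self_star x
    have h2 := S.V_pos _ (Good.cons (S.emb_psd c _ h1) hL)
    rw [← trace_Dm] at h2
    rw [trace_mul_comm, mul_vecMulVec, trace_vecMulVec, dotProduct_comm] at h2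
    exact h2
  refine posSemidef_iff_dotProduct_mulVec.2 ⟨?_, key⟩
  rw [← isSymmetric_toEuclideanLin_iff, LinearMap.isSymmetric_iff_inner_map_self_real]
  intro v
  have h := key v.ofLp
  have e : inner ℂ (toEuclideanLin (S.Dm c L) v) v = star (star v.ofLp ⬝ᵥ (S.Dm c L) *ᵥ v.ofLp) := by
    rw [EuclideanSpace.inner_eq_star_dotProduct, star_dotProduct, dotProduct_comm]
    simp [toLpLin_apply]
  rw [e]
  have h4 := (Complex.le_def.1 h).2
  rw [Complex.conj_eq_iff_im]
  simp only [Complex.star_def, Complex.conj_im]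
  rw [← h4]; simp

lemma Dm_perm (c : C) {L L' : List (Matrix β β ℂ)} (h : L.Perm L') (hL : L.length < k) :
    S.Dm c L = S.Dm c L' := by
  ext b a
  simp only [Dm, of_apply]
  exact S.V_perm _ _ (h.cons _) (by simpa using hL)

lemma Dm_sum {X : Type*} (s : Finset X) (F : X → Matrix β β ℂ) (c : C)
    (L : List (Matrix β β ℂ)) (hL : L.length + 2 ≤ k) :
    S.Dm c ((∑ x ∈ s, F x) :: L) = ∑ x ∈ s, S.Dm c (F x :: L) := by
  ext b a
  rw [Matrix.sum_apply]
  simp only [Dm, of_apply]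
  have : ∀ X Y, S.V (X :: Y :: L) = S.V (Y :: X :: L) := fun X Y =>
    S.V_perm _ _ (List.Perm.swap _ _ _) (by simp; omega)
  simp only [this (S.emb c _), V_cons, map_sum]

lemma Dm_one (c : C) (L : List (Matrix β β ℂ)) (hL : L.length + 2 ≤ k) :
    S.Dm c (1 :: L) = S.Dm c L := by
  ext b a
  simp only [Dm, of_apply]
  rw [S.V_perm _ _ (List.Perm.swap _ _ _) (by simp; omega), S.V_one _ (by simp; omega)]

lemma trace_Dm' (c : C) (L : List (Matrix β β ℂ)) (hL : L.length < k) :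
    (S.Dm c L).trace = S.V L := by
  have := S.trace_Dm c L 1
  rwa [one_mul, emb_one, V_one _ _ hL] at this

lemma sum_cons {t : ℕ} {ι : Fin (t + 1) → Type} [∀ j, Fintype (ι j)] {A : Type*}
    [AddCommMonoid A] (F : (∀ j, ι j) → A) :
    ∑ y, F y = ∑ a : ι 0, ∑ y : ∀ j : Fin t, ι j.succ, F (Fin.cons a y) := by
  rw [← Fintype.sum_prod_type' (fun a y => F (Fin.cons a y))]
  exact (Fintype.sum_equiv (Fin.consEquiv ι) _ _ fun _ => rfl).symm

/-- entropy after measuring `s` further blocks -/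
def HL (c : C) (s : ℕ) (Z : List (Matrix β β ℂ)) : ℝ :=
  ∑ x : Fin s → Ω, entS (S.Dm c (List.ofFn (fun j => S.E (x j)) ++ Z))

lemma sum_Dm (c : C) : ∀ (t : ℕ) (ι : Fin t → Type) [∀ j, Fintype (ι j)]
    (B : ∀ j, ι j → Matrix β β ℂ) (_ : ∀ j, ∑ a, B j a = 1) (Z : List (Matrix β β ℂ))
    (_ : t + 1 + Z.length ≤ k),
    ∑ y : ∀ j, ι j, S.Dm c (List.ofFn (fun j => B j (y j)) ++ Z) = S.Dm c Z := by
  intro t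
  induction t with
  | zero => intro ι _ B hB Z hZ; simp
  | succ t ih =>
    intro ι _ B hB Z hZ
    rw [sum_cons, Finset.sum_comm]
    simp only [List.ofFn_succ, Fin.cons_zero, Fin.cons_succ, List.cons_append]
    rw [← ih (fun j => ι j.succ) (fun j => B j.succ) (fun j => hB j.succ) Z (by omega)]
    refine Finset.sum_congr rfl fun y _ => ?_
    rw [← S.Dm_sum _ _ _ _ (by simp; omega), hB, S.Dm_one _ _ (by simp; omega)]

lemma sum_V (c : C) (t : ℕ) (ι : Fin t → Type) [∀ j, Fintype (ι j)]
    (B : ∀ j, ι j → Matrix β β ℂ) (hB : ∀ j, ∑ a, B j a = 1) (Z : List (Matrix β β ℂ))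
    (hZ : t + 1 + Z.length ≤ k) :
    ∑ y : ∀ j, ι j, S.V (List.ofFn (fun j => B j (y j)) ++ Z) = S.V Z := by
  have := congrArg Matrix.trace (S.sum_Dm c t ι B hB Z hZ)
  rw [trace_sum, S.trace_Dm' _ _ (by omega)] at this
  rw [← this]
  exact Finset.sum_congr rfl fun y _ => (S.trace_Dm' _ _ (by simp; omega)).symm

lemma HL_le (c : C) : ∀ (t : ℕ) (ι : Fin t → Type) [∀ j, Fintype (ι j)] [∀ j, DecidableEq (ι j)]
    (B : ∀ j, ι j → Matrix β β ℂ) (π : ∀ j, Ω → ι j) (_ : ∀ j a, (B j a).PosSemidef)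
    (_ : ∀ j a, B j a = ∑ x with π j x = a, S.E x) (Z : List (Matrix β β ℂ)) (_ : Good Z)
    (_ : t + 1 + Z.length ≤ k),
    S.HL c t Z ≤ ∑ y : ∀ j, ι j, entS (S.Dm c (List.ofFn (fun j => B j (y j)) ++ Z)) := by
  intro t
  induction t with
  | zero => intro ι _ _ B π _ hB Z hG hZ; simp [HL]
  | succ t ih =>
    intro ι _ _ B π hBp hB Z hG hZ
    have hperm : ∀ (X : Matrix β β ℂ) (L : List (Matrix β β ℂ)), L.length = t →
        S.Dm c (X :: (L ++ Z)) = S.Dm c (L ++ (X :: Z)) := by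
      intro X L hL
      exact S.Dm_perm c List.perm_middle.symm (by simp; omega)
    calc S.HL c (t + 1) Z = ∑ x0, S.HL c t (S.E x0 :: Z) := by
          rw [HL, sum_cons]
          refine Finset.sum_congr rfl fun x0 _ => ?_
          rw [HL]
          refine Finset.sum_congr rfl fun y _ => ?_
          simp only [List.ofFn_succ, Fin.cons_zero, Fin.cons_succ, List.cons_append]
          rw [hperm _ _ (by simp)]
      _ ≤ ∑ x0, ∑ y : ∀ j : Fin t, ι j.succ,
            entS (S.Dm c (List.ofFn (fun j => B j.succ (y j)) ++ (S.E x0 :: Z))) := by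
          refine Finset.sum_le_sum fun x0 _ => ?_
          exact ih (fun j => ι j.succ) (fun j => B j.succ) (fun j => π j.succ)
            (fun j => hBp j.succ) (fun j => hB j.succ) _ (Good.cons (S.E_psd x0) hG)
            (by simp; omega)
      _ = ∑ a : ι 0, ∑ x0 with π 0 x0 = a, ∑ y : ∀ j : Fin t, ι j.succ,
            entS (S.Dm c (List.ofFn (fun j => B j.succ (y j)) ++ (S.E x0 :: Z))) := by
          rw [Finset.sum_fiberwise]
      _ ≤ _ := by
          rw [sum_cons]
          refine Finset.sum_le_sum fun a _ => ?_
          rw [Finset.sum_comm]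
          refine Finset.sum_le_sum fun y _ => ?_
          simp only [List.ofFn_succ, Fin.cons_zero, Fin.cons_succ, List.cons_append]
          rw [hB 0 a, S.Dm_sum _ _ _ _ (by simp; omega)]
          rw [Finset.sum_congr rfl fun x0 _ => by rw [← hperm _ _ (by simp)]]
          refine (ensemble_bound _ _ (fun _ => 0) ?_ (fun _ _ => PosSemidef.zero)
            (fun _ _ => by simpa using PosSemidef.one)).2
          intro x _
          exact S.Dm_psd _ _ (Good.cons (S.E_psd x)
            (Good.append (Good.ofFn fun j => hBp _ _) hG))

end Sys
end DF

namespace DF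
open Matrix

variable {k : ℕ} {d β Ω C : Type} [Fintype d] [DecidableEq d] [Fintype β] [DecidableEq β]
    [Fintype Ω]

namespace Sys
variable (S : Sys k d β Ω C)

/-- normalized conditional state -/
def Dh (c : C) (Z : List (Matrix β β ℂ)) : Matrix d d ℂ := (1 / S.V Z) • S.Dm c Z

lemma V_real (Z : List (Matrix β β ℂ)) (hZ : Good Z) : S.V Z = (((S.V Z).re : ℝ) : ℂ) := by
  have := (Complex.le_def.1 (S.V_pos Z hZ)).2
  apply Complex.ext <;> simp at this ⊢
  exact this.symm

lemma V_re_nonneg (Z : List (Matrix β β ℂ)) (hZ : Good Z) : 0 ≤ (S.V Z).re :=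
  (Complex.le_def.1 (S.V_pos Z hZ)).1

lemma Dh_psd (c : C) (Z : List (Matrix β β ℂ)) (hZ : Good Z) : (S.Dh c Z).PosSemidef := by
  rw [Dh, S.V_real Z hZ]
  refine (S.Dm_psd c Z hZ).smul ?_
  have := S.V_re_nonneg Z hZ
  rw [← Complex.ofReal_one, ← Complex.ofReal_div]
  exact_mod_cast (by positivity : (0:ℝ) ≤ 1 / (S.V Z).re)

lemma tr_re_nonneg {G D : Matrix d d ℂ} (hG : G.PosSemidef) (hD : D.PosSemidef) :
    0 ≤ (G * D).trace.re := (Complex.le_def.1 (trace_mul_psd hG hD)).1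

lemma Dh_tr_le (c : C) (Z : List (Matrix β β ℂ)) (hZ : Good Z) (hl : Z.length < k)
    {G : Matrix d d ℂ} (hG1 : (1 - G).PosSemidef) :
    (G * S.Dh c Z).trace.re ≤ 1 := by
  have h1 := tr_re_nonneg hG1 (S.Dh_psd c Z hZ)
  rw [sub_mul, one_mul, trace_sub, Complex.sub_re] at h1
  have h2 : (S.Dh c Z).trace.re ≤ 1 := by
    rw [Dh, trace_smul, S.trace_Dm' _ _ hl, smul_eq_mul]
    by_cases h : S.V Z = 0
    · simp [h]
    · rw [one_div, inv_mul_cancel₀ h]; simp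
  linarith

lemma step (t : ℕ) (ι : Fin t → Type) [∀ j, Fintype (ι j)] [∀ j, DecidableEq (ι j)]
    (Z : List (Matrix β β ℂ)) (hZ : Good Z)
    (c : C) (B : ∀ j, ι j → Matrix β β ℂ)
    (hB : ∀ j a, (B j a).PosSemidef) (hBsum : ∀ j, ∑ a, B j a = 1)
    (π : ∀ j, Ω → ι j) (hπ : ∀ j a, B j a = ∑ x with π j x = a, S.E x)
    (G : (∀ j, ι j) → Matrix d d ℂ) (hG : ∀ a, (G a).PosSemidef) (hG1 : ∀ a, (1 - G a).PosSemidef)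
    (hk : t + 1 + Z.length ≤ k) :
    |∑ a, (S.V (S.emb c (G a) :: (List.ofFn (fun j => B j (a j)) ++ Z))).re -
      ∑ a, (G a * S.Dh c Z).trace.re * (S.V (List.ofFn (fun j => B j (a j)) ++ Z)).re| ≤
    √((S.V Z).re * (entS (S.Dm c Z) - S.HL c t Z)) := by
  have h1 := S.sum_Dm c t ι B hBsum Z hk
  have hgood : ∀ a : ∀ j, ι j, Good (List.ofFn (fun j => B j (a j)) ++ Z) := fun a =>
    Good.append (Good.ofFn fun j => hB _ _) hZ
  have h2 := (ensemble_bound Finset.univ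
    (fun y : ∀ j, ι j => S.Dm c (List.ofFn (fun j => B j (y j)) ++ Z)) G
    (fun y _ => S.Dm_psd _ _ (hgood y)) (fun y _ => hG y) (fun y _ => hG1 y)).1
  rw [h1, S.trace_Dm' c Z (by omega)] at h2
  have h3 := S.HL_le c t ι B π hB hπ Z hZ hk
  have h4 : √((S.V Z).re * (entS (S.Dm c Z) -
      ∑ y : ∀ j, ι j, entS (S.Dm c (List.ofFn (fun j => B j (y j)) ++ Z)))) ≤
      √((S.V Z).re * (entS (S.Dm c Z) - S.HL c t Z)) := by
    apply Real.sqrt_le_sqrt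
    exact mul_le_mul_of_nonneg_left (by linarith) (S.V_re_nonneg Z hZ)
  refine le_trans ?_ (h2.trans h4)
  rw [← Finset.sum_sub_distrib]
  refine (Finset.abs_sum_le_sum_abs _ _).trans (Finset.sum_le_sum fun y _ => ?_)
  refine le_trans (le_of_eq ?_) (Complex.abs_re_le_norm _)
  congr 1
  rw [S.trace_Dm' _ _ (by simp; omega), mul_sub, trace_sub, trace_Dm, Complex.sub_re]
  congr 1
  have : ((S.V (List.ofFn (fun j => B j (y j)) ++ Z) / S.V Z) • S.Dm c Z) =
      S.V (List.ofFn (fun j => B j (y j)) ++ Z) • S.Dh c Z := by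
    rw [Dh, smul_smul]; congr 1; ring
  rw [this, mul_smul_comm, trace_smul, smul_eq_mul, S.V_real _ (hgood y), Complex.re_ofReal_mul,
    Complex.ofReal_re, mul_comm]

theorem hybrid (Z : List (Matrix β β ℂ)) (hZ : Good Z) : ∀ (t : ℕ)
    (ι : Fin t → Type) [∀ j, Fintype (ι j)] [∀ j, DecidableEq (ι j)]
    (e : Fin (t + 1) → C) (Q : ∀ j, ι j → Matrix d d ℂ)
    (_ : ∀ j a, (Q j a).PosSemidef) (_ : ∀ j, ∑ a, Q j a = 1)
    (π : ∀ j, Ω → ι j)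
    (_ : ∀ (j : Fin t) a, S.emb (e j.succ) (Q j a) = ∑ x with π j x = a, S.E x)
    (G : (∀ j, ι j) → Matrix d d ℂ) (_ : ∀ a, (G a).PosSemidef) (_ : ∀ a, (1 - G a).PosSemidef)
    (_ : t + 1 + Z.length ≤ k),
    |∑ a, (S.V (S.emb (e 0) (G a) ::
        (List.ofFn (fun j : Fin t => S.emb (e j.succ) (Q j (a j))) ++ Z))).re -
      (S.V Z).re * ∑ a, (G a * S.Dh (e 0) Z).trace.re *
        ∏ j : Fin t, (Q j (a j) * S.Dh (e j.succ) Z).trace.re| ≤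
    ∑ m : Fin (t + 1), √((S.V Z).re * (entS (S.Dm (e m) Z) - S.HL (e m) (t - m) Z)) := by
  intro t
  induction t with
  | zero =>
    intro ι _ _ e Q hQ hQs π hπ G hG hG1 hk
    have h := S.step 0 ι Z hZ (e 0) (fun j => j.elim0) (fun j => j.elim0) (fun j => j.elim0)
      π (fun j => j.elim0) G hG hG1 hk
    simp only [List.ofFn_zero, List.nil_append, Finset.univ_eq_empty, Finset.prod_empty,
      mul_one, ← Finset.sum_mul] at h ⊢
    rw [mul_comm]
    simpa using h
  | succ t ih =>
    intro ι _ _ e Q hQ hQs π hπ G hG hG1 hk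
    have h := S.step (t + 1) ι Z hZ (e 0) (fun j a => S.emb (e j.succ) (Q j a))
      (fun j a => S.emb_psd _ _ (hQ j a))
      (fun j => by rw [← map_sum, hQs, S.emb_one]) π hπ G hG hG1 hk
    set cf : (∀ j, ι j) → ℝ := fun a => (G a * S.Dh (e 0) Z).trace.re with hcf
    have hcf0 : ∀ a, 0 ≤ cf a := fun a => tr_re_nonneg (hG a) (S.Dh_psd _ _ hZ)
    have hcf1 : ∀ a, cf a ≤ 1 := fun a => S.Dh_tr_le _ _ hZ (by omega) (hG1 a)
    set G' : (∀ j : Fin t, ι j.succ) → Matrix d d ℂ := fun a' =>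
      ∑ a0 : ι 0, ((cf (Fin.cons a0 a') : ℝ) : ℂ) • Q 0 a0 with hG'
    have h2 := ih (fun j => ι j.succ) (fun j => e j.succ) (fun j => Q j.succ)
      (fun j => hQ j.succ) (fun j => hQs j.succ) (fun j => π j.succ) (fun j => hπ j.succ) G'
      (fun a' => posSemidef_sum _ fun a0 _ => (hQ 0 a0).smul (by exact_mod_cast hcf0 _))
      (fun a' => by
        rw [hG', ← hQs 0]
        simp only
        rw [← Finset.sum_sub_distrib]
        refine posSemidef_sum _ fun a0 _ => ?_
        have : Q 0 a0 - ((cf (Fin.cons a0 a') : ℝ) : ℂ) • Q 0 a0 =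
            ((1 - cf (Fin.cons a0 a') : ℝ) : ℂ) • Q 0 a0 := by
          push_cast; rw [sub_smul, one_smul]
        rw [this]
        exact (hQ 0 a0).smul (by
          have := hcf1 (Fin.cons a0 a')
          exact_mod_cast (by linarith : (0:ℝ) ≤ 1 - cf (Fin.cons a0 a'))))
      (by omega)
    have e1 : ∑ a : ∀ j, ι j, cf a *
          (S.V (List.ofFn (fun j : Fin (t+1) => S.emb (e j.succ) (Q j (a j))) ++ Z)).re =
        ∑ a : ∀ j : Fin t, ι j.succ, (S.V (S.emb (e (Fin.succ 0)) (G' a) ::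
          (List.ofFn (fun j : Fin t => S.emb (e j.succ.succ) (Q j.succ (a j))) ++ Z))).re := by
      rw [sum_cons, Finset.sum_comm]
      refine Finset.sum_congr rfl fun a' _ => ?_
      rw [hG', V_cons, map_sum, map_sum, Complex.re_sum]
      refine Finset.sum_congr rfl fun a0 _ => ?_
      rw [map_smul, map_smul, smul_eq_mul, Complex.re_ofReal_mul]
      simp only [List.ofFn_succ, Fin.cons_zero, Fin.cons_succ, List.cons_append, V_cons]
    have e2 : ∑ a : ∀ j, ι j, cf a *
          ∏ j : Fin (t + 1), (Q j (a j) * S.Dh (e j.succ) Z).trace.re =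
        ∑ a : ∀ j : Fin t, ι j.succ, (G' a * S.Dh (e (Fin.succ 0)) Z).trace.re *
          ∏ j : Fin t, (Q j.succ (a j) * S.Dh (e j.succ.succ) Z).trace.re := by
      rw [sum_cons, Finset.sum_comm]
      refine Finset.sum_congr rfl fun a' _ => ?_
      rw [hG', Finset.sum_mul, trace_sum, Complex.re_sum, Finset.sum_mul]
      refine Finset.sum_congr rfl fun a0 _ => ?_
      rw [Fin.prod_univ_succ, smul_mul_assoc, trace_smul, smul_eq_mul, Complex.re_ofReal_mul]
      simp only [Fin.cons_zero, Fin.cons_succ, mul_assoc]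
    rw [e1] at h
    rw [e2, Fin.sum_univ_succ]
    refine (abs_sub_le _ _ _).trans (add_le_add h (h2.trans (le_of_eq ?_)))
    refine Finset.sum_congr rfl fun m _ => ?_
    rw [Fin.val_succ, Nat.add_sub_add_right]

end Sys
end DF

namespace DF
open Matrix

variable {k : ℕ} {d β Ω C : Type} [Fintype d] [DecidableEq d] [Fintype β] [DecidableEq β]
    [Fintype Ω]

namespace Sys
variable (S : Sys k d β Ω C)

lemma good_E {s : ℕ} (x : Fin s → Ω) : Good (List.ofFn (fun j => S.E (x j))) :=
  Good.ofFn fun _ => S.E_psd _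

lemma HL_nonneg (c : C) (s : ℕ) (Z : List (Matrix β β ℂ)) (hZ : Good Z) : 0 ≤ S.HL c s Z :=
  Finset.sum_nonneg fun x _ => entS_nonneg (S.Dm_psd _ _ (Good.append (S.good_E x) hZ))

lemma HL_le_ent (c : C) (s : ℕ) (Z : List (Matrix β β ℂ)) (hZ : Good Z)
    (hk : s + 1 + Z.length ≤ k) : S.HL c s Z ≤ entS (S.Dm c Z) := by
  have h1 := S.sum_Dm c s (fun _ => Ω) (fun _ => S.E) (fun _ => S.E_sum) Z hk
  have h2 := (ensemble_bound Finset.univ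
    (fun y : Fin s → Ω => S.Dm c (List.ofFn (fun j => S.E (y j)) ++ Z)) (fun _ => 0)
    (fun y _ => S.Dm_psd _ _ (Good.append (S.good_E y) hZ)) (fun _ _ => PosSemidef.zero)
    (fun _ _ => by simpa using PosSemidef.one)).2
  rw [h1] at h2
  exact h2

lemma HL_le_log (c : C) (s : ℕ) (hk : s + 1 ≤ k) :
    S.HL c s [] ≤ Real.log (Fintype.card d) := by
  have hg : Good ([] : List (Matrix β β ℂ)) := by intro X hX; simp at hX
  refine (S.HL_le_ent c s [] hg (by simpa using hk)).trans ?_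
  refine (entS_le (S.Dm_psd c [] hg)).trans ?_
  rw [S.trace_Dm' c [] (by simp; omega), S.V_nil]; simp

lemma HL_append (c : C) (s r : ℕ) :
    ∑ z : Fin r → Ω, S.HL c s (List.ofFn (fun j => S.E (z j))) = S.HL c (s + r) [] := by
  unfold HL
  rw [Finset.sum_comm,
    ← Fintype.sum_prod_type' (fun (x : Fin s → Ω) (z : Fin r → Ω) => entS (S.Dm c
      (List.ofFn (fun j => S.E (x j)) ++ List.ofFn (fun j => S.E (z j)))))]
  refine Fintype.sum_equiv (Fin.appendEquiv s r) _ _ ?_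
  rintro ⟨x, z⟩
  rw [List.append_nil, ← List.ofFn_fin_append]
  congr 3
  ext j : 1
  refine Fin.addCases (fun i => ?_) (fun i => ?_) j <;> simp [Fin.appendEquiv]

lemma telescope (f : ℕ → ℝ) (Λ : ℝ) (K s k : ℕ) (h0 : ∀ i, 0 ≤ f i) (h1 : ∀ i, i + 1 ≤ k → f i ≤ Λ)
    (hs : s ≤ k) : ∑ r ∈ Finset.range K, (f r - f (s + r)) ≤ s * Λ := by
  have e1 := Finset.sum_range_add f K s
  have e2 := Finset.sum_range_add f s K
  rw [add_comm K s] at e1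
  rw [Finset.sum_sub_distrib]
  have h2 : ∑ r ∈ Finset.range s, f r ≤ s * Λ := by
    have := Finset.sum_le_sum (s := Finset.range s) (f := f) (g := fun _ => Λ)
      (fun i hi => h1 i (by have := Finset.mem_range.1 hi; omega))
    simpa using this
  have h3 : 0 ≤ ∑ r ∈ Finset.range s, f (K + r) := Finset.sum_nonneg fun _ _ => h0 _
  linarith

theorem average (t : ℕ)
    (ι : Fin t → Type) [∀ j, Fintype (ι j)] [∀ j, DecidableEq (ι j)]
    (e : Fin (t + 1) → C) (Q : ∀ j, ι j → Matrix d d ℂ)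
    (hQ : ∀ j a, (Q j a).PosSemidef) (hQs : ∀ j, ∑ a, Q j a = 1)
    (π : ∀ j, Ω → ι j)
    (hπ : ∀ (j : Fin t) a, S.emb (e j.succ) (Q j a) = ∑ x with π j x = a, S.E x)
    (G : (∀ j, ι j) → Matrix d d ℂ) (hG : ∀ a, (G a).PosSemidef) (hG1 : ∀ a, (1 - G a).PosSemidef)
    (hk : t + 1 < k) (h : ℝ)
    (hprod : ∀ Z : List (Matrix β β ℂ), Good Z → Z.length < k → S.V Z ≠ 0 →
      ∑ a, (G a * S.Dh (e 0) Z).trace.re *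
        ∏ j : Fin t, (Q j (a j) * S.Dh (e j.succ) Z).trace.re ≤ h) :
    ∑ a, (S.V (S.emb (e 0) (G a) ::
        (List.ofFn (fun j : Fin t => S.emb (e j.succ) (Q j (a j)))))).re ≤
      h + √((t + 1 : ℝ) ^ 3 * Real.log (Fintype.card d) / ((k : ℝ) - (t + 1))) := by
  set v := ∑ a, (S.V (S.emb (e 0) (G a) ::
        (List.ofFn (fun j : Fin t => S.emb (e j.succ) (Q j (a j)))))).re with hv
  set Λ := Real.log (Fintype.card d)
  obtain ⟨K, hK⟩ : ∃ K, k = K + (t + 1) := ⟨k - (t + 1), by omega⟩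
  have hKpos : 0 < K := by omega
  set Δ : Fin (t + 1) → ℕ → ℝ := fun m r => S.HL (e m) r [] - S.HL (e m) ((t - m) + r) [] with hΔ
  have hnil : ∀ (c : C) (r : ℕ), ∑ z : Fin r → Ω, entS (S.Dm c (List.ofFn (fun j => S.E (z j)))) =
      S.HL c r [] := by
    intro c r; simp [HL]
  have hΔz : ∀ m r, Δ m r = ∑ z : Fin r → Ω, (entS (S.Dm (e m) (List.ofFn (fun j => S.E (z j)))) -
      S.HL (e m) (t - m) (List.ofFn (fun j => S.E (z j)))) := by
    intro m r
    rw [Finset.sum_sub_distrib, hnil, HL_append]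
  have hΔz0 : ∀ (m : Fin (t + 1)) r, r < K → ∀ z : Fin r → Ω,
      0 ≤ entS (S.Dm (e m) (List.ofFn (fun j => S.E (z j)))) -
      S.HL (e m) (t - m) (List.ofFn (fun j => S.E (z j))) := by
    intro m r hr z
    have := S.HL_le_ent (e m) (t - m) _ (S.good_E z) (by simp; omega)
    linarith
  have hΔ0 : ∀ m r, r < K → 0 ≤ Δ m r := fun m r hr => by
    rw [hΔz]; exact Finset.sum_nonneg fun z _ => hΔz0 m r hr z
  have hone : ∀ r, r < K → ∑ z : Fin r → Ω, (S.V (List.ofFn (fun j => S.E (z j)))).re = 1 := by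
    intro r hr
    have := S.sum_V (e 0) r (fun _ => Ω) (fun _ => S.E) (fun _ => S.E_sum) [] (by simp; omega)
    simp only [List.append_nil] at this
    rw [← Complex.re_sum, this, S.V_nil]; simp
  have per : ∀ r, r < K → v ≤ h + ∑ m, √(Δ m r) := by
    intro r hr
    have hvz : v = ∑ z : Fin r → Ω, ∑ a, (S.V (S.emb (e 0) (G a) ::
        (List.ofFn (fun j : Fin t => S.emb (e j.succ) (Q j (a j))) ++
          List.ofFn (fun j => S.E (z j))))).re := by
      rw [hv, Finset.sum_comm]
      refine Finset.sum_congr rfl fun a _ => ?_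
      rw [← S.sum_V (e 0) r (fun _ => Ω) (fun _ => S.E) (fun _ => S.E_sum) _ (by simp; omega),
        Complex.re_sum]
      refine Finset.sum_congr rfl fun z _ => ?_
      congr 1
      refine S.V_perm _ _ ?_ (by simp; omega)
      exact (List.perm_append_comm).trans (by simp)
    have hz : ∀ z : Fin r → Ω, ∑ a, (S.V (S.emb (e 0) (G a) ::
        (List.ofFn (fun j : Fin t => S.emb (e j.succ) (Q j (a j))) ++
          List.ofFn (fun j => S.E (z j))))).re ≤ (S.V (List.ofFn (fun j => S.E (z j)))).re * h +
        ∑ m : Fin (t + 1), √(S.V (List.ofFn (fun j => S.E (z j)))).re *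
          √(entS (S.Dm (e m) (List.ofFn (fun j => S.E (z j)))) -
            S.HL (e m) (t - m) (List.ofFn (fun j => S.E (z j)))) := by
      intro z
      have h1 := S.hybrid _ (S.good_E z) t ι e Q hQ hQs π hπ G hG hG1 (by simp; omega)
      have h2 := (abs_le.1 h1).2
      have hp0 := S.V_re_nonneg _ (S.good_E z)
      simp only [Real.sqrt_mul hp0] at h2
      have h3 : (S.V (List.ofFn (fun j => S.E (z j)))).re *
          ∑ a, (G a * S.Dh (e 0) (List.ofFn (fun j => S.E (z j)))).trace.re *
        ∏ j : Fin t, (Q j (a j) * S.Dh (e j.succ) (List.ofFn (fun j => S.E (z j)))).trace.re ≤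
        (S.V (List.ofFn (fun j => S.E (z j)))).re * h := by
        by_cases hV : S.V (List.ofFn (fun j => S.E (z j))) = 0
        · rw [hV]; simp
        · exact mul_le_mul_of_nonneg_left (hprod _ (S.good_E z) (by simp; omega) hV) hp0
      linarith
    rw [hvz]
    refine (Finset.sum_le_sum fun z _ => hz z).trans ?_
    rw [Finset.sum_add_distrib, ← Finset.sum_mul, hone r hr, one_mul, Finset.sum_comm]
    refine add_le_add_right (Finset.sum_le_sum fun m _ => ?_) h
    refine (sum_sqrt_mul_sqrt_le' _ _ _ (fun z _ => S.V_re_nonneg _ (S.good_E z))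
      (fun z _ => hΔz0 m r hr z)).trans ?_
    rw [hone r hr, ← hΔz]; simp
  have hΛ0 : 0 ≤ Λ := Real.log_natCast_nonneg _
  have tot : ∑ p ∈ Finset.range K ×ˢ (Finset.univ : Finset (Fin (t + 1))), Δ p.2 p.1 ≤
      (t + 1 : ℝ) ^ 2 * Λ := by
    rw [Finset.sum_product_right]
    calc _ ≤ ∑ m : Fin (t + 1), ((t + 1 : ℝ) * Λ) := by
          refine Finset.sum_le_sum fun m _ => ?_
          refine (telescope (fun r => S.HL (e m) r []) Λ K (t - m) k
            (fun i => S.HL_nonneg _ _ _ (by intro X hX; simp at hX))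
            (fun i hi => S.HL_le_log (e m) i hi) (by omega)).trans ?_
          refine mul_le_mul_of_nonneg_right ?_ hΛ0
          have : (t - (m : ℕ) : ℕ) ≤ t + 1 := by omega
          exact_mod_cast this
      _ = _ := by simp; ring
  have sumup : (K : ℝ) * v ≤ K * h + √((K * (t + 1) : ℝ)) * √((t + 1 : ℝ) ^ 2 * Λ) := by
    have h1 : ∑ r ∈ Finset.range K, v ≤ ∑ r ∈ Finset.range K, (h + ∑ m, √(Δ m r)) :=
      Finset.sum_le_sum fun r hr => per r (Finset.mem_range.1 hr)
    rw [Finset.sum_add_distrib] at h1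
    simp only [Finset.sum_const, Finset.card_range, nsmul_eq_mul] at h1
    rw [← Finset.sum_product' _ _ (fun r m => √(Δ m r))] at h1
    have h2 := sum_sqrt_mul_sqrt_le' (Finset.range K ×ˢ (Finset.univ : Finset (Fin (t + 1))))
      (fun _ => 1) (fun p => Δ p.2 p.1) (fun _ _ => zero_le_one)
      (fun p hp => hΔ0 _ _ (Finset.mem_range.1 (Finset.mem_product.1 hp).1))
    simp only [Real.sqrt_one, one_mul, Finset.sum_const, Finset.card_product, Finset.card_range,
      Finset.card_univ, Fintype.card_fin, nsmul_eq_mul, mul_one] at h2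
    push_cast at h2
    have h3 := mul_le_mul_of_nonneg_left (Real.sqrt_le_sqrt tot) (Real.sqrt_nonneg (K * (t + 1) : ℝ))
    linarith
  have hKR : (0:ℝ) < K := by exact_mod_cast hKpos
  have hkK : (k : ℝ) - (t + 1) = K := by rw [hK]; push_cast; ring
  rw [hkK]
  have e3 : √((K * (t + 1) : ℝ)) * √((t + 1 : ℝ) ^ 2 * Λ) =
      K * √((t + 1 : ℝ) ^ 3 * Λ / K) := by
    rw [← Real.sqrt_mul (by positivity)]
    have : (K : ℝ) = √((K : ℝ) ^ 2) := (Real.sqrt_sq hKR.le).symm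
    conv_rhs => rw [this]
    rw [← Real.sqrt_mul (by positivity), Real.sqrt_sq hKR.le]
    congr 1
    field_simp
  rw [e3, ← mul_add] at sumup
  exact le_of_mul_le_mul_left sumup hKR

end Sys
end DF

namespace DF
open Matrix

section piT
variable {I d : Type} [Fintype I] [DecidableEq I] [Fintype d] [DecidableEq d]

/-- tensor product of a family of matrices -/
def piT (A : I → Matrix d d ℂ) : Matrix (I → d) (I → d) ℂ :=
  Matrix.of fun f g => ∏ i, A i (f i) (g i)

lemma piT_apply (A : I → Matrix d d ℂ) (f g : I → d) : piT A f g = ∏ i, A i (f i) (g i) := rfl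

lemma piT_mul (A B : I → Matrix d d ℂ) : piT A * piT B = piT (fun i => A i * B i) := by
  ext f g
  simp only [piT_apply, Matrix.mul_apply, Finset.prod_univ_sum, Fintype.piFinset_univ,
    Finset.prod_mul_distrib]

lemma piT_one : piT (fun _ : I => (1 : Matrix d d ℂ)) = 1 := by
  ext f g
  simp only [piT_apply, Matrix.one_apply]
  rw [Fintype.prod_ite_zero]
  simp [funext_iff]

lemma piT_trace (A : I → Matrix d d ℂ) : (piT A).trace = ∏ i, (A i).trace := by
  simp only [trace, diag_apply, piT_apply, Finset.prod_univ_sum, Fintype.piFinset_univ]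

lemma psd_factor {A : Matrix d d ℂ} (hA : A.PosSemidef) : ∃ B : Matrix d d ℂ, A = Bᴴ * B := by
  obtain ⟨U, b, hb, -, -, h, -⟩ := psd_spectral hA
  refine ⟨diagonal (fun i => ((√(b i) : ℝ) : ℂ)) * Uᴴ, ?_⟩
  rw [conjTranspose_mul, conjTranspose_conjTranspose, diagonal_conjTranspose, Matrix.mul_assoc U,
    ← Matrix.mul_assoc (diagonal _), diagonal_mul_diagonal, ← Matrix.mul_assoc, h]
  congr 3
  funext i
  simp only [Pi.star_apply, Complex.star_def, Complex.conj_ofReal]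
  rw [← Complex.ofReal_mul, Real.mul_self_sqrt (hb i)]

lemma piT_psd (A : I → Matrix d d ℂ) (hA : ∀ i, (A i).PosSemidef) : (piT A).PosSemidef := by
  have : ∀ i, ∃ B : Matrix d d ℂ, A i = Bᴴ * B := fun i =>
    psd_factor (hA i)
  choose B hB using this
  have h : piT A = (piT B)ᴴ * piT B := by
    have : (piT B)ᴴ = piT (fun i => (B i)ᴴ) := by
      ext f g
      simp [piT_apply]
    rw [this, piT_mul]
    congr 1; funext i; exact hB i
  rw [h]
  exact posSemidef_conjTranspose_mul_self _

/-- the tensor product as a linear function of one slot -/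
def piU (c : I) (A : I → Matrix d d ℂ) : Matrix d d ℂ →ₗ[ℂ] Matrix (I → d) (I → d) ℂ where
  toFun X := piT (Function.update A c X)
  map_add' X Y := by
    ext f g
    simp only [piT_apply, Matrix.add_apply]
    rw [← Finset.mul_prod_erase _ _ (Finset.mem_univ c), ← Finset.mul_prod_erase _ _ (Finset.mem_univ c),
      ← Finset.mul_prod_erase _ _ (Finset.mem_univ c)]
    simp only [Function.update_self, Matrix.add_apply, add_mul]
    congr 2 <;>
    · refine Finset.prod_congr rfl fun i hi => ?_
      rw [Function.update_of_ne (Finset.ne_of_mem_erase hi), Function.update_of_ne (Finset.ne_of_mem_erase hi)]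
  map_smul' r X := by
    ext f g
    simp only [piT_apply, Matrix.smul_apply, RingHom.id_apply]
    rw [← Finset.mul_prod_erase _ _ (Finset.mem_univ c), ← Finset.mul_prod_erase _ _ (Finset.mem_univ c)]
    simp only [Function.update_self, Matrix.smul_apply, smul_eq_mul, mul_assoc]
    congr 2
    refine Finset.prod_congr rfl fun i hi => ?_
    rw [Function.update_of_ne (Finset.ne_of_mem_erase hi), Function.update_of_ne (Finset.ne_of_mem_erase hi)]

lemma piU_apply (c : I) (A : I → Matrix d d ℂ) (X : Matrix d d ℂ) :
    piU c A X = piT (Function.update A c X) := rfl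

end piT

lemma perm_fin {α : Type*} {k : ℕ} (L L' : List α) (h : L.Perm L') (hL : L.length = k) (x : α) :
    ∃ σ : Equiv.Perm (Fin k), ∀ i : Fin k, L'.getD (σ i) x = L.getD i x := by
  classical
  subst hL
  refine ⟨⟨fun i => Fin.cast h.length_eq.symm (h.idxBij i),
    fun i => h.symm.idxBij (Fin.cast h.length_eq i), ?_, ?_⟩, ?_⟩
  · intro i
    simpa using h.idxBij_symm_idxBij (i := i)
  · intro i
    have := h.idxBij_idxBij_symm (i := Fin.cast h.length_eq i)
    simp only [this]
    simp
  · intro i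
    have := h.getElem_idxBij_eq_getElem i
    simp only [Equiv.coe_fn_mk, Fin.val_cast]
    rw [List.getD_eq_getElem _ _ (h.idxBij i).2, List.getD_eq_getElem _ _ i.2]
    exact this

lemma perm_fin' {α : Type*} {k : ℕ} (L L' : List α) (h : L.Perm L') (hL : L.length ≤ k) (x : α) :
    ∃ σ : Equiv.Perm (Fin k), ∀ i : Fin k, L'.getD (σ i) x = L.getD i x := by
  have hp : ∀ (L : List α) (m i : ℕ), (L ++ List.replicate m x).getD i x = L.getD i x := by
    intro L m i
    simp only [List.getD_eq_getElem?_getD, List.getElem?_append, List.getElem?_replicate]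
    split_ifs with h1 h2
    · rfl
    · simp [List.getElem?_eq_none (not_lt.1 h1)]
    · simp [List.getElem?_eq_none (not_lt.1 h1)]
  obtain ⟨σ, hσ⟩ := perm_fin (k := k) (L ++ List.replicate (k - L.length) x)
    (L' ++ List.replicate (k - L.length) x) (h.append_right _) (by simp; omega) x
  refine ⟨σ, fun i => ?_⟩
  have := hσ i
  rwa [hp, hp] at this
end DF

namespace DF
open Matrix

lemma trace_piT_perm {I d : Type} [Fintype I] [DecidableEq I] [Fintype d] [DecidableEq d]
    (ρ : Matrix (I → d) (I → d) ℂ) (σ : Equiv.Perm I)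
    (hs : ∀ f f' : I → d, ρ (f ∘ σ) (f' ∘ σ) = ρ f f') (A : I → Matrix d d ℂ) :
    (piT (fun i => A (σ i)) * ρ).trace = (piT A * ρ).trace := by
  simp only [trace, diag_apply, Matrix.mul_apply, piT_apply]
  let e : (I → d) ≃ (I → d) := Equiv.arrowCongr σ.symm (Equiv.refl d)
  have he : ∀ f, e f = f ∘ σ := fun f => rfl
  rw [← Equiv.sum_comp e]
  refine Finset.sum_congr rfl fun f _ => ?_
  rw [← Equiv.sum_comp e]
  refine Finset.sum_congr rfl fun g _ => ?_
  rw [he, he, hs]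
  congr 1
  exact Equiv.prod_comp σ (fun i => A i (f i) (g i))

/-- the functional associated with a state on the blocks -/
def Vfun {k : ℕ} {β : Type} [Fintype β] [DecidableEq β] (ρ : Matrix (Fin k → β) (Fin k → β) ℂ)
    (L : List (Matrix β β ℂ)) : ℂ :=
  (piT (fun i : Fin k => L.getD i 1) * ρ).trace

lemma Vfun_perm {k : ℕ} {β : Type} [Fintype β] [DecidableEq β]
    (ρ : Matrix (Fin k → β) (Fin k → β) ℂ)
    (hs : ∀ (π : Equiv.Perm (Fin k)) (f f' : Fin k → β), ρ (f ∘ π) (f' ∘ π) = ρ f f')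
    (L L' : List (Matrix β β ℂ)) (h : L.Perm L') (hL : L.length ≤ k) : Vfun ρ L = Vfun ρ L' := by
  obtain ⟨σ, hσ⟩ := perm_fin' L L' h hL 1
  have := trace_piT_perm ρ σ (hs σ) (fun i => L'.getD i 1)
  rw [Vfun, Vfun, ← this]
  simp only [hσ]

lemma getD_psd {β : Type} [Fintype β] [DecidableEq β] (L : List (Matrix β β ℂ))
    (hL : ∀ X ∈ L, X.PosSemidef) (i : ℕ) : (L.getD i 1).PosSemidef := by
  by_cases h : i < L.length
  · rw [List.getD_eq_getElem _ _ h]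
    exact hL _ (List.getElem_mem h)
  · rw [List.getD_eq_default _ _ (not_lt.1 h)]
    exact PosSemidef.one

/-- filtered sums over product outcome sets -/
lemma sum_filter_pi {t : ℕ} {ι : Fin t → Type} [∀ j, Fintype (ι j)] [∀ j, DecidableEq (ι j)]
    (F : ∀ j, ι j → ℂ) (j : Fin t) (a : ι j) :
    ∑ x : (∀ j, ι j) with x j = a, ∏ i, F i (x i) =
      ∏ i, if i = j then F j a else ∑ b, F i b := by
  have h1 : (Finset.univ.filter fun x : (∀ j, ι j) => x j = a) =
      Fintype.piFinset (Function.update (fun i => (Finset.univ : Finset (ι i))) j {a}) := by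
    ext x
    simp only [Finset.mem_filter, Finset.mem_univ, true_and, Fintype.mem_piFinset]
    constructor
    · intro h i
      by_cases hi : i = j
      · subst hi; simp [h]
      · simp [hi]
    · intro h
      simpa using h j
  rw [h1, ← Finset.prod_univ_sum]
  refine Finset.prod_congr rfl fun i _ => ?_
  split_ifs with h
  · subst h; simp
  · simp [h]

section mk
variable {k t : ℕ} {d : Type} [Fintype d] [DecidableEq d]
  {ι : Fin t → Type} [∀ j, Fintype (ι j)] [∀ j, DecidableEq (ι j)]

/-- product measurement on a block -/
def Emeas (Q : ∀ j, ι j → Matrix d d ℂ) (x : ∀ j, ι j) :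
    Matrix (Fin (t + 1) → d) (Fin (t + 1) → d) ℂ :=
  piT (Fin.cons 1 (fun j => Q j (x j)) : Fin (t + 1) → Matrix d d ℂ)

lemma Emeas_apply (Q : ∀ j, ι j → Matrix d d ℂ) (x : ∀ j, ι j) (f g : Fin (t + 1) → d) :
    Emeas Q x f g = (1 : Matrix d d ℂ) (f 0) (g 0) * ∏ j, Q j (x j) (f j.succ) (g j.succ) := by
  simp [Emeas, piT_apply, Fin.prod_univ_succ]

lemma Emeas_sum (Q : ∀ j, ι j → Matrix d d ℂ) (hQs : ∀ j, ∑ a, Q j a = 1) :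
    ∑ x, Emeas Q x = 1 := by
  rw [← piT_one (I := Fin (t + 1))]
  ext f g
  rw [Matrix.sum_apply]
  simp only [Emeas_apply, piT_apply, Fin.prod_univ_succ]
  have h := Finset.prod_univ_sum (fun i => (Finset.univ : Finset (ι i)))
    (fun i b => Q i b (f i.succ) (g i.succ))
  rw [Fintype.piFinset_univ] at h
  rw [← Finset.mul_sum, ← h]
  simp only [← Matrix.sum_apply, hQs]

lemma Emeas_marg (Q : ∀ j, ι j → Matrix d d ℂ) (hQs : ∀ j, ∑ a, Q j a = 1) (j : Fin t) (a : ι j) :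
    piU j.succ (fun _ => 1) (Q j a) = ∑ x with x j = a, Emeas Q x := by
  ext f g
  rw [Matrix.sum_apply]
  simp only [Emeas_apply, piU_apply, piT_apply, Fin.prod_univ_succ]
  rw [← Finset.mul_sum, sum_filter_pi (fun i b => Q i b (f i.succ) (g i.succ))]
  rw [Function.update_of_ne (Fin.succ_ne_zero j).symm]
  congr 1
  refine Finset.prod_congr rfl fun i _ => ?_
  split_ifs with h
  · subst h; simp
  · rw [← Matrix.sum_apply, hQs, Function.update_of_ne (fun hh => h (Fin.succ_injective _ hh))]

/-- the concrete system -/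
def mkSys (hk : 0 < k)
    (ρ : Matrix (Fin k → Fin (t + 1) → d) (Fin k → Fin (t + 1) → d) ℂ)
    (hρ : ρ.PosSemidef) (htr : ρ.trace = 1)
    (hs : ∀ (π : Equiv.Perm (Fin k)) (f f' : Fin k → Fin (t + 1) → d),
      ρ (f ∘ π) (f' ∘ π) = ρ f f')
    (Q : ∀ j, ι j → Matrix d d ℂ) (hQ : ∀ j a, (Q j a).PosSemidef) (hQs : ∀ j, ∑ a, Q j a = 1) :
    Sys k d (Fin (t + 1) → d) (∀ j, ι j) (Fin (t + 1)) where
  V := Vfun ρ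
  Vlin L := (traceLinearMap _ ℂ ℂ) ∘ₗ (LinearMap.mulRight ℂ ρ) ∘ₗ
    (piU (⟨0, hk⟩ : Fin k) (fun i => ((1 : Matrix _ _ ℂ) :: L).getD i 1))
  V_cons X L := by
    simp only [Vfun, LinearMap.comp_apply, piU_apply, LinearMap.mulRight_apply,
      traceLinearMap_apply]
    congr 3
    funext i
    by_cases h : i = ⟨0, hk⟩
    · subst h; simp
    · rw [Function.update_of_ne h]
      obtain ⟨m, hm⟩ : ∃ m, (i : ℕ) = m + 1 := Nat.exists_eq_succ_of_ne_zero
        (fun h0 => h (Fin.ext h0))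
      rw [hm]; simp
  V_perm := Vfun_perm ρ hs
  V_one L hL := by
    rw [Vfun_perm ρ hs (1 :: L) (L ++ [1]) (List.perm_append_singleton _ _).symm (by simpa using hL)]
    rw [Vfun, Vfun]
    congr 3
    funext i
    simp only [List.getD_eq_getElem?_getD, List.getElem?_append]
    split_ifs with h
    · rfl
    · rw [List.getElem?_eq_none (not_lt.1 h)]
      rcases Nat.eq_zero_or_pos ((i : ℕ) - L.length) with h0 | h0
      · simp [h0]
      · rw [List.getElem?_eq_none (by simp only [List.length_singleton]; omega)]
  V_pos L hL := trace_mul_psd (piT_psd _ fun i => getD_psd L hL i) hρ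
  V_nil := by
    have : (fun i : Fin k => ([] : List (Matrix (Fin (t + 1) → d) (Fin (t + 1) → d) ℂ)).getD i 1) =
      fun _ => 1 := by funext i; simp
    rw [Vfun, this, piT_one, one_mul, htr]
  emb c := piU c (fun _ => 1)
  emb_one c := by
    rw [piU_apply, Function.update_eq_self_iff.2 rfl, piT_one]
  emb_psd c G hG := by
    rw [piU_apply]
    refine piT_psd _ fun i => ?_
    by_cases h : i = c
    · subst h; simpa using hG
    · rw [Function.update_of_ne h]; exact PosSemidef.one
  E := Emeas Q
  E_psd x := by
    refine piT_psd _ fun i => ?_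
    refine Fin.cases ?_ (fun j => ?_) i
    · simpa using PosSemidef.one
    · simpa using hQ _ _
  E_sum := Emeas_sum Q hQs
end mk
end DF

namespace DF
open Matrix

lemma embed_piT {n l k : ℕ} (hlk : l ≤ k) (T : Fin l → Matrix (Fin n) (Fin n) ℂ) :
    embedDiag hlk (piT T) =
      piT (fun i : Fin k => piT (fun j : Fin l => if (i : ℕ) = j then T j else 1)) := by
  ext g g'
  simp only [embedDiag, of_apply, piT_apply]
  rw [Finset.prod_comm]
  split_ifs with h
  · refine Finset.prod_congr rfl fun j _ => ?_
    rw [Finset.prod_eq_single (Fin.castLE hlk j)]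
    · simp
    · intro i _ hi
      have hij : (i : ℕ) ≠ j := fun h' => hi (Fin.ext (by simpa using h'))
      rw [if_neg hij, h i j hij, one_apply_eq]
    · intro h; exact absurd (Finset.mem_univ _) h
  · push Not at h
    obtain ⟨i, j, hij, hne⟩ := h
    refine (Finset.prod_eq_zero (Finset.mem_univ j) (Finset.prod_eq_zero (Finset.mem_univ i) ?_)).symm
    rw [if_neg hij, one_apply_ne hne]

lemma embed_sum {n l k : ℕ} (hlk : l ≤ k) {X : Type*} (s : Finset X)
    (M : X → Matrix (Fin l → Fin n) (Fin l → Fin n) ℂ) :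
    embedDiag hlk (∑ x ∈ s, M x) = ∑ x ∈ s, embedDiag hlk (M x) := by
  ext g g'
  rw [Matrix.sum_apply]
  simp only [embedDiag, of_apply]
  split_ifs with h
  · rw [Matrix.sum_apply]
  · simp

lemma V_embed {n l k : ℕ} (hlk : l ≤ k) (T : Fin l → Matrix (Fin n) (Fin n) ℂ)
    (ρ : Matrix (Fin k → Fin l → Fin n) (Fin k → Fin l → Fin n) ℂ) :
    Vfun ρ (List.ofFn fun j => piU j (fun _ => 1) (T j)) = (embedDiag hlk (piT T) * ρ).trace := by
  rw [embed_piT, Vfun]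
  congr 3
  funext i
  by_cases h : (i : ℕ) < l
  · rw [List.getD_eq_getElem _ _ (by simpa using h), List.getElem_ofFn, piU_apply]
    congr 1
    funext j
    by_cases hj : j = ⟨i, h⟩
    · subst hj; simp
    · rw [Function.update_of_ne hj, if_neg]
      exact fun h' => hj (Fin.ext h'.symm)
  · rw [List.getD_eq_default _ _ (by simpa using h), ← piT_one]
    congr 1
    funext j
    rw [if_neg]
    have := j.2
    omega

lemma embed_prod {n l k : ℕ} (hlk : l ≤ k) (T r : Fin l → Matrix (Fin n) (Fin n) ℂ)
    (hr : ∀ j, (r j).trace = 1) :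
    (embedDiag hlk (piT T) * piT (fun _ : Fin k => piT r)).trace = (piT T * piT r).trace := by
  rw [embed_piT, piT_mul, piT_trace, piT_mul, piT_trace]
  simp only [piT_mul, piT_trace]
  rw [Finset.prod_comm]
  refine Finset.prod_congr rfl fun j _ => ?_
  rw [Finset.prod_eq_single (Fin.castLE hlk j)]
  · simp
  · intro i _ hi
    have hij : (i : ℕ) ≠ j := fun h' => hi (Fin.ext (by simpa using h'))
    rw [if_neg hij, one_mul, hr]
  · intro h; exact absurd (Finset.mem_univ _) h

/-- the set whose supremum is the symmetric value -/
def symSet {n l k : ℕ} (hlk : l ≤ k)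
    (M : Matrix (Fin l → Fin n) (Fin l → Fin n) ℂ) : Set ℝ :=
  {v : ℝ | ∃ ρ : Matrix (Fin k → Fin l → Fin n) (Fin k → Fin l → Fin n) ℂ,
    IsState ρ ∧
    (∀ (π : Equiv.Perm (Fin k)) (f f' : Fin k → Fin l → Fin n),
      ρ (f ∘ π) (f' ∘ π) = ρ f f') ∧
    v = ((embedDiag hlk M * ρ).trace).re}

/-- the set whose supremum is the separable value -/
def sepSet {n l : ℕ}
    (M : Matrix (Fin l → Fin n) (Fin l → Fin n) ℂ) : Set ℝ :=
  {v : ℝ | ∃ σ, IsFullySeparable σ ∧ v = ((M * σ).trace).re}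

lemma sep_subset {n l k : ℕ} (hlk : l ≤ k) {X : Type*} (s : Finset X)
    (T : X → Fin l → Matrix (Fin n) (Fin n) ℂ) :
    sepSet (∑ x ∈ s, piT (T x)) ⊆ symSet (k := k) hlk (∑ x ∈ s, piT (T x)) := by
  rintro v ⟨σ, ⟨N, w, r, hw, hw1, hr, rfl⟩, rfl⟩
  refine ⟨∑ i, (w i : ℂ) • piT (fun _ : Fin k => piT (r i)), ⟨?_, ?_⟩, ?_, ?_⟩
  · refine posSemidef_sum _ fun i _ => ?_
    refine PosSemidef.smul (piT_psd _ fun _ => piT_psd _ fun j => (hr i j).1) ?_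
    exact_mod_cast hw i
  · rw [trace_sum]
    simp only [trace_smul, piT_trace, (hr _ _).2, Finset.prod_const_one, smul_eq_mul, mul_one]
    exact_mod_cast hw1
  · intro π f f'
    simp only [Matrix.sum_apply, Matrix.smul_apply]
    refine Finset.sum_congr rfl fun i _ => ?_
    congr 1
    exact Equiv.prod_comp π (fun m => piT (r i) (f m) (f' m))
  · congr 1
    rw [Finset.mul_sum, Finset.mul_sum, trace_sum, trace_sum]
    refine Finset.sum_congr rfl fun i _ => ?_
    rw [embed_sum, Matrix.mul_smul, Matrix.mul_smul, trace_smul, trace_smul, Finset.sum_mul,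
      Finset.sum_mul, trace_sum, trace_sum]
    congr 1
    refine Finset.sum_congr rfl fun x _ => ?_
    rw [embed_prod hlk _ _ fun j => (hr i j).2]
    rfl

lemma product_mem {n l : ℕ} (M : Matrix (Fin l → Fin n) (Fin l → Fin n) ℂ)
    (r : Fin l → Matrix (Fin n) (Fin n) ℂ) (hr : ∀ j, IsState (r j)) :
    (M * piT r).trace.re ∈ sepSet M :=
  ⟨piT r, ⟨1, fun _ => 1, fun _ => r, fun _ => zero_le_one, by simp, fun _ j => hr j,
    by simp [piT]⟩, rfl⟩

lemma sep_nonempty {n l : ℕ} (hn : 1 ≤ n) (M : Matrix (Fin l → Fin n) (Fin l → Fin n) ℂ) :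
    (sepSet M).Nonempty := by
  refine ⟨_, product_mem M (fun _ => Matrix.single ⟨0, hn⟩ ⟨0, hn⟩ 1) fun _ => ⟨?_, ?_⟩⟩
  · rw [← diagonal_single]
    refine PosSemidef.diagonal ?_
    intro i
    by_cases h : i = ⟨0, hn⟩
    · subst h; simp
    · simp [h]
  · simp

section core
variable {n t k : ℕ} (hn : 1 ≤ n) (hlk : t + 1 < k)
    {ι : Fin t → Type} [∀ j, Fintype (ι j)] [∀ j, DecidableEq (ι j)]
    (P : (∀ j, ι j) → Matrix (Fin n) (Fin n) ℂ)
    (Q : ∀ j, ι j → Matrix (Fin n) (Fin n) ℂ)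

/-- tuple of local operators -/
def tup (a : ∀ j, ι j) : Fin (t + 1) → Matrix (Fin n) (Fin n) ℂ := Fin.cons (P a) (fun j => Q j (a j))


lemma value_eq (hQ : ∀ j i, (Q j i).PosSemidef) (hQs : ∀ j, ∑ i, Q j i = 1)
    (hk : 0 < k) (ρ : Matrix (Fin k → Fin (t + 1) → Fin n) (Fin k → Fin (t + 1) → Fin n) ℂ)
    (hρ : ρ.PosSemidef) (htr : ρ.trace = 1)
    (hs : ∀ (π : Equiv.Perm (Fin k)) (f f' : Fin k → Fin (t + 1) → Fin n),
      ρ (f ∘ π) (f' ∘ π) = ρ f f') :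
    (embedDiag hlk.le (∑ a, piT (tup P Q a)) * ρ).trace.re =
      ∑ a, ((mkSys hk ρ hρ htr hs Q hQ hQs).V ((mkSys hk ρ hρ htr hs Q hQ hQs).emb 0 (P a) ::
        (List.ofFn (fun j : Fin t => (mkSys hk ρ hρ htr hs Q hQ hQs).emb j.succ (Q j (a j)))))).re := by
  rw [embed_sum, Finset.sum_mul, trace_sum, Complex.re_sum]
  refine Finset.sum_congr rfl fun a _ => ?_
  rw [← V_embed, List.ofFn_succ]
  rfl

lemma sym_bdd
    (hP : ∀ i, (P i).PosSemidef ∧ ((1 : Matrix (Fin n) (Fin n) ℂ) - P i).PosSemidef)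
    (hQ : ∀ j i, (Q j i).PosSemidef) (hQs : ∀ j, ∑ i, Q j i = 1) :
    BddAbove (symSet (k := k) hlk.le (∑ a, piT (tup P Q a))) := by
  refine ⟨1, ?_⟩
  rintro v ⟨ρ, ⟨hρ, htr⟩, hs, rfl⟩
  have hk : 0 < k := by omega
  rw [value_eq hlk P Q hQ hQs hk ρ hρ htr hs]
  set S := mkSys hk ρ hρ htr hs Q hQ hQs
  have h1 := S.sum_V 0 t ι (fun j a => S.emb j.succ (Q j a))
    (fun j => by rw [← map_sum, hQs, S.emb_one]) [] (by simp; omega)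
  simp only [List.append_nil, S.V_nil] at h1
  have h2 := congrArg Complex.re h1
  rw [Complex.re_sum, Complex.one_re] at h2
  rw [← h2]
  refine Finset.sum_le_sum fun a _ => ?_
  have hg : Sys.Good (List.ofFn fun j => S.emb j.succ (Q j (a j))) :=
    Sys.Good.ofFn fun j => S.emb_psd _ _ (hQ _ _)
  have h3 := S.V_re_nonneg _ (Sys.Good.cons (S.emb_psd 0 _ (hP a).2) hg)
  rw [S.V_cons, map_sub, map_sub, S.emb_one, ← S.V_cons, ← S.V_cons,
    S.V_one _ (by simp; omega), Complex.sub_re] at h3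
  linarith

lemma core_upper
    (hP : ∀ i, (P i).PosSemidef ∧ ((1 : Matrix (Fin n) (Fin n) ℂ) - P i).PosSemidef)
    (hQ : ∀ j i, (Q j i).PosSemidef) (hQs : ∀ j, ∑ i, Q j i = 1)
    (h0 : BddAbove (sepSet (∑ a, piT (tup P Q a)))) :
    ∀ v ∈ symSet (k := k) hlk.le (∑ a, piT (tup P Q a)),
      v ≤ hSep (∑ a, piT (tup P Q a)) +
        √(2 * (t + 1 : ℝ) ^ 3 * Real.log n / ((k : ℝ) - (t + 1))) := by
  rintro v ⟨ρ, ⟨hρ, htr⟩, hs, rfl⟩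
  have hk : 0 < k := by omega
  rw [value_eq hlk P Q hQ hQs hk ρ hρ htr hs]
  set S := mkSys hk ρ hρ htr hs Q hQ hQs with hS
  have main := S.average t ι id Q hQ hQs (fun j x => x j)
    (fun j a => Emeas_marg Q hQs j a) P (fun a => (hP a).1) (fun a => (hP a).2) hlk
    (hSep (∑ a, piT (tup P Q a))) ?_
  · refine main.trans (add_le_add le_rfl (Real.sqrt_le_sqrt ?_))
    have hkt : (0 : ℝ) < (k : ℝ) - (t + 1) := by
      have : ((t + 1 : ℕ) : ℝ) < k := by exact_mod_cast hlk
      push_cast at this; linarith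
    rw [Fintype.card_fin]
    have hlog : 0 ≤ Real.log n := Real.log_natCast_nonneg n
    refine div_le_div_of_nonneg_right ?_ hkt.le
    have : 0 ≤ (t + 1 : ℝ) ^ 3 * Real.log n := by positivity
    nlinarith
  · intro Z hZ hl hV
    have hst : ∀ c, IsState (S.Dh c Z) := fun c => by
      refine ⟨S.Dh_psd c Z hZ, ?_⟩
      rw [Sys.Dh, trace_smul, S.trace_Dm' _ _ hl, smul_eq_mul, one_div, inv_mul_cancel₀ hV]
    have hmem := product_mem (∑ a, piT (tup P Q a)) (fun c => S.Dh c Z) hst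
    refine le_trans (le_of_eq ?_) (le_csSup h0 hmem)
    rw [Finset.sum_mul, trace_sum, Complex.re_sum]
    refine Finset.sum_congr rfl fun a _ => ?_
    rw [piT_mul, piT_trace, Fin.prod_univ_succ]
    simp only [tup, Fin.cons_zero, Fin.cons_succ, id]
    rw [psd_re (hP a).1 (hst 0).1, Finset.prod_congr rfl fun j _ => psd_re (hQ j (a j)) (hst j.succ).1,
      ← Complex.ofReal_prod, ← Complex.ofReal_mul, Complex.ofReal_re]
    simp only [Complex.ofReal_re]

theorem core (hn : 1 ≤ n)
    (hP : ∀ i, (P i).PosSemidef ∧ ((1 : Matrix (Fin n) (Fin n) ℂ) - P i).PosSemidef)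
    (hQ : ∀ j i, (Q j i).PosSemidef) (hQs : ∀ j, ∑ i, Q j i = 1) :
    hSep (∑ a, piT (tup P Q a)) ≤ maxBlockSymValue (k := k) hlk.le (∑ a, piT (tup P Q a)) ∧
    maxBlockSymValue (k := k) hlk.le (∑ a, piT (tup P Q a)) ≤
      hSep (∑ a, piT (tup P Q a)) +
        √(2 * (t + 1 : ℝ) ^ 3 * Real.log n / ((k : ℝ) - (t + 1))) := by
  have hb := sym_bdd hlk P Q hP hQ hQs
  have hsub := sep_subset hlk.le Finset.univ (tup P Q)
  have hne := sep_nonempty hn (∑ a, piT (tup P Q a))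
  exact ⟨csSup_le_csSup hb hne hsub,
    csSup_le (hne.mono hsub) (core_upper hlk P Q hP hQ hQs (hb.mono hsub))⟩
end core

end DF

theorem hSep_block_symmetric_sandwich
    {n l' k : ℕ} (hn : 1 ≤ n) (hlk : l' + 1 < k)
    {ι : Fin l' → Type} [∀ j, Fintype (ι j)]
    (P : (∀ j, ι j) → Matrix (Fin n) (Fin n) ℂ)
    (Qm : ∀ j, ι j → Matrix (Fin n) (Fin n) ℂ)
    (hP : ∀ i, (P i).PosSemidef ∧ ((1 : Matrix (Fin n) (Fin n) ℂ) - P i).PosSemidef)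
    (hQ : ∀ j i, (Qm j i).PosSemidef)
    (hQsum : ∀ j, ((1 : Matrix (Fin n) (Fin n) ℂ) - ∑ i, Qm j i).PosSemidef)
    (M : Matrix (Fin (l' + 1) → Fin n) (Fin (l' + 1) → Fin n) ℂ)
    (hM : M = Matrix.of fun f g => ∑ i : ∀ j, ι j,
      P i (f 0) (g 0) * ∏ j, Qm j (i j) (f j.succ) (g j.succ)) :
    hSep M ≤ maxBlockSymValue (k := k) hlk.le M ∧
    maxBlockSymValue (k := k) hlk.le M ≤
      hSep M + Real.sqrt (2 * (l' + 1 : ℝ) ^ 3 * Real.log n / ((k : ℝ) - (l' + 1))) := by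
  classical
  let e : (∀ j, ι j) → (∀ j, Option (ι j)) := fun i j => some (i j)
  have he : Function.Injective e := fun i i' h => funext fun j => Option.some_injective _ (congrFun h j)
  let P' : (∀ j, Option (ι j)) → Matrix (Fin n) (Fin n) ℂ := Function.extend e P 0
  let Q' : ∀ j, Option (ι j) → Matrix (Fin n) (Fin n) ℂ :=
    fun j o => o.elim (1 - ∑ i, Qm j i) (Qm j)
  have hP' : ∀ a, (P' a).PosSemidef ∧ ((1 : Matrix (Fin n) (Fin n) ℂ) - P' a).PosSemidef := by
    intro a
    by_cases h : ∃ i, e i = a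
    · obtain ⟨i, rfl⟩ := h
      simpa only [P', he.extend_apply] using hP i
    · simp only [P', Function.extend_apply' _ _ _ h, Pi.zero_apply, sub_zero]
      exact ⟨Matrix.PosSemidef.zero, Matrix.PosSemidef.one⟩
  have hQ' : ∀ j i, (Q' j i).PosSemidef := by
    intro j i
    cases i with
    | none => exact hQsum j
    | some i => exact hQ j i
  have hQs' : ∀ j, ∑ i, Q' j i = 1 := by
    intro j
    rw [Fintype.sum_option]
    simp [Q']
  have hMe : M = ∑ a, DF.piT (DF.tup P' Q' a) := by
    rw [hM]
    ext f g
    rw [Matrix.sum_apply, Matrix.of_apply]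
    refine Fintype.sum_of_injective e he _ _ ?_ ?_
    · intro a ha
      rw [DF.piT_apply, Fin.prod_univ_succ]
      simp only [DF.tup, Fin.cons_zero, P']
      rw [Function.extend_apply' _ _ _ (by simpa using ha)]
      simp
    · intro i
      rw [DF.piT_apply, Fin.prod_univ_succ]
      simp only [DF.tup, Fin.cons_zero, Fin.cons_succ, P', he.extend_apply]
      rfl
  rw [hMe]
  exact DF.core hlk P' Q' hn hP' hQ' hQs'

end
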